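/- arXiv:1208.2185 — 5 statements merged into one kernel-verified Lean document; each statement's English description precedes it below -/
import Mathlib

section
/- T(M11(E)) is contained in the T-ideal generated by the single polynomial [[t1,t2][t3,t4],t5]; that is, every polynomial identity of M11(E) is a consequence of [[t1,t2][t3,t4],t5] (even though this polynomial is not itself an identity of M11(E)). -/
noncomputable section

open CliffordAlgebra

/-- The Grassmann algebra of an infinite-dimensional vector space (free on countably many
generators), with its even part `evenOdd 0 0` and odd part `evenOdd 0 1`. -/
abbrev GrassmannAlg (K : Type*) [Field K] := ExteriorAlgebra K (ℕ →₀ K)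

/-- `M11(E)`: the subalgebra of 2×2 matrices over the Grassmann algebra `E` whose diagonal
entries are even and whose off-diagonal entries are odd. -/
def M11 (K : Type*) [Field K] :
    Subalgebra K (Matrix (Fin 2) (Fin 2) (GrassmannAlg K)) where
  carrier := {A | A 0 0 ∈ evenOdd (0 : QuadraticForm K (ℕ →₀ K)) 0 ∧
                  A 1 1 ∈ evenOdd (0 : QuadraticForm K (ℕ →₀ K)) 0 ∧
                  A 0 1 ∈ evenOdd (0 : QuadraticForm K (ℕ →₀ K)) 1 ∧
                  A 1 0 ∈ evenOdd (0 : QuadraticForm K (ℕ →₀ K)) 1}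
  add_mem' := by
    rintro A B ⟨h1, h2, h3, h4⟩ ⟨g1, g2, g3, g4⟩
    exact ⟨add_mem h1 g1, add_mem h2 g2, add_mem h3 g3, add_mem h4 g4⟩
  mul_mem' := by
    rintro A B ⟨h1, h2, h3, h4⟩ ⟨g1, g2, g3, g4⟩
    have e00 : ((0 : ZMod 2) + 0) = 0 := by decide
    have e11 : ((1 : ZMod 2) + 1) = 0 := by decide
    have e01 : ((0 : ZMod 2) + 1) = 1 := by decide
    have e10 : ((1 : ZMod 2) + 0) = 1 := by decide
    refine ⟨?_, ?_, ?_, ?_⟩ <;>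
      simp only [Set.mem_setOf_eq, Matrix.mul_apply, Fin.sum_univ_two]
    · exact add_mem (e00 ▸ SetLike.mul_mem_graded h1 g1)
        (e11 ▸ SetLike.mul_mem_graded h3 g4)
    · exact add_mem (e11 ▸ SetLike.mul_mem_graded h4 g3)
        (e00 ▸ SetLike.mul_mem_graded h2 g2)
    · exact add_mem (e01 ▸ SetLike.mul_mem_graded h1 g3)
        (e10 ▸ SetLike.mul_mem_graded h3 g2)
    · exact add_mem (e10 ▸ SetLike.mul_mem_graded h4 g1)
        (e01 ▸ SetLike.mul_mem_graded h2 g4)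
  algebraMap_mem' := by
    intro r
    refine ⟨?_, ?_, ?_, ?_⟩ <;>
      simp only [Set.mem_setOf_eq, Matrix.algebraMap_matrix_apply]
    · simpa using SetLike.algebraMap_mem_graded (evenOdd (0 : QuadraticForm K (ℕ →₀ K))) r
    · simpa using SetLike.algebraMap_mem_graded (evenOdd (0 : QuadraticForm K (ℕ →₀ K))) r
    · simp [zero_mem (evenOdd (0 : QuadraticForm K (ℕ →₀ K)) 1)]
    · simp [zero_mem (evenOdd (0 : QuadraticForm K (ℕ →₀ K)) 1)]
/-- The commutator `[a,b] = a*b - b*a`. -/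
def br {A : Type*} [Ring A] (a b : A) : A := a * b - b * a

/-- The free generators of the free unital associative algebra `K⟨t1, t2, ...⟩`;
`tv K i` corresponds to `t_{i+1}`. -/
def tv (K : Type*) [Field K] (i : ℕ) : FreeAlgebra K ℕ := FreeAlgebra.ι K i

/-- The polynomial `[[t1,t2][t3,t4],t5]`. -/
def p₁ (K : Type*) [Field K] : FreeAlgebra K ℕ :=
  br (br (tv K 0) (tv K 1) * br (tv K 2) (tv K 3)) (tv K 4)

/-- The T-ideal of `K⟨t1, t2, ...⟩` generated by a set `S`: the two-sided ideal generated by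
all images of elements of `S` under unital `K`-algebra endomorphisms of the free algebra. -/
def TIdealGen (K : Type*) [Field K] (S : Set (FreeAlgebra K ℕ)) :
    TwoSidedIdeal (FreeAlgebra K ℕ) :=
  TwoSidedIdeal.span
    {g | ∃ f ∈ S, ∃ φ : FreeAlgebra K ℕ →ₐ[K] FreeAlgebra K ℕ, g = φ f}

/-- `T(A)`: the set of polynomial identities of a unital associative `K`-algebra `A`. -/
def polyIdentities (K : Type*) [Field K] (A : Type*) [Ring A] [Algebra K A] :
    Set (FreeAlgebra K ℕ) :=
  {f | ∀ φ : FreeAlgebra K ℕ →ₐ[K] A, φ f = 0}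

set_option linter.unusedSectionVars false
set_option linter.unusedSimpArgs false
section ident
variable {R : Type*} [Ring R]

/-- product of two commutators is central -/
def HH (R : Type*) [Ring R] : Prop := ∀ a b c d e : R, br a b * br c d * e = e * (br a b * br c d)

lemma br_self (a : R) : br a a = 0 := by simp [br]
lemma br_swap (a b : R) : br a b = - br b a := by simp [br]

lemma A1 (H : HH R) (p q a b d e : R) :
    br p q * br a b * br d e = -(br p q * br a d * br b e) := by
  have h1 := H p q a (b*d) e
  have h2 := H p q a b e
  have h3 := H p q a d e
  have h4 := H (br p q) b a d e
  have h5 := H p q a d (br b e)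
  have e1 : br p q * br a (b*d) = br p q * br a b * d + b * (br p q * br a d)
      + br (br p q) b * br a d := by unfold br; noncomm_ring
  rw [e1] at h1
  rw [h5]
  generalize br p q * br a b = u at *
  generalize br p q * br a d = v at *
  generalize br (br p q) b * br a d = w at *
  have : u * br d e + br b e * v = (u * d + b * v + w) * e - e * (u * d + b * v + w)
     - ((u * e - e * u) * d + b * (v * e - e * v) + (w * e - e * w)) := by
    unfold br; noncomm_ring
  rw [h1, h2, h3, h4] at this
  simp only [sub_self, zero_mul, mul_zero, add_zero] at this
  exact eq_neg_of_add_eq_zero_left this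

lemma A2 (H : HH R) (p q a b d e : R) :
    br a b * br d e * br p q = -(br a d * br b e * br p q) := by
  rw [H, H a d b e, ← mul_assoc, ← mul_assoc, A1 H]

lemma A4 (H : HH R) (p q a b d e : R) :
    br p q * br a b * br d e = br a b * br p q * br d e := by
  rw [mul_assoc, ← H a b d e (br p q)]
  -- ab de pq = ab pq de
  rw [A1 H a b d e p q, A1 H a b p q d e, br_swap p d, br_swap q e]
  simp

lemma A3 (K : Type*) [Field K] [CharZero K] [Algebra K R] (H : HH R) (a b c d e f g : R) :
    br (br a b) c * br d e * br f g = 0 := by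
  have key : ∀ a b x p q y z : R, br (br a b) x * br p q * br y z
      = (2:K) • (br (br p q) a * br b x * br y z) := by
    intro a b x p q y z
    have h1 := H p q b x a
    have h2 := H p q a x b
    have e1 : br p q * br (br a b) x * br y z
        = (br (br p q) a * br b x * br y z - br (br p q) b * br a x * br y z)
        - (br p q * br b x * a - a * (br p q * br b x)) * br y z
        + (br p q * br a x * b - b * (br p q * br a x)) * br y z := by
      unfold br; noncomm_ring
    rw [h1, h2, A2 H y z (br p q) b a x, A4 H] at e1
    rw [e1, two_smul]; simp
  have h1 := key a b c d e f g
  have h2 := key d e c a b f g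
  -- h(d,e | a b c) = h(d,e| c a b)
  have h3 : br (br d e) a * br b c * br f g = br (br d e) c * br a b * br f g := by
    rw [br_swap b c, mul_neg, neg_mul, A2 H f g (br d e) a c b, neg_neg]
  have h4 : br (br a b) d * br e c * br f g = br (br a b) c * br d e * br f g := by
    rw [br_swap e c, mul_neg, neg_mul, A2 H f g (br a b) d c e, neg_neg]
  rw [h3, h2, h4, smul_smul] at h1
  have : (3:K) • (br (br a b) c * br d e * br f g) = 0 := by
    have h5 : (2*2:K) • (br (br a b) c * br d e * br f g) - br (br a b) c * br d e * br f g = 0 := by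
      rw [← h1, sub_self]
    rw [← h5, show (2*2:K) = 3 + 1 by norm_num, add_smul, one_smul, add_sub_cancel_right]
  exact (smul_eq_zero.1 this).resolve_left (by norm_num)

end ident

section polyact
variable {K : Type*} [Field K]

lemma exists_polyHom {σ V : Type*} [AddCommGroup V] [Module K V] (T : σ → Module.End K V)
    (hT : ∀ i j, T i * T j = T j * T i) :
    ∃ A : MvPolynomial σ K →ₐ[K] Module.End K V, ∀ i, A (MvPolynomial.X i) = T i := by
  have hc : ∀ a ∈ Set.range T, ∀ b ∈ Set.range T, a * b = b * a := by
    rintro _ ⟨i, rfl⟩ _ ⟨j, rfl⟩; exact hT i j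
  letI := Algebra.adjoinCommRingOfComm K hc
  let B : MvPolynomial σ K →ₐ[K] Algebra.adjoin K (Set.range T) :=
    MvPolynomial.aeval (fun i => ⟨T i, Algebra.subset_adjoin ⟨i, rfl⟩⟩)
  refine ⟨(Algebra.adjoin K (Set.range T)).val.comp B, fun i => ?_⟩
  simp [B]

lemma exists_polyAct {σ V : Type*} [AddCommGroup V] [Module K V] (T : σ → Module.End K V)
    (W Z : Submodule K V) (hW : ∀ i, ∀ v ∈ W, T i v ∈ W) (hZ : ∀ i, ∀ v ∈ Z, T i v ∈ Z)
    (hc : ∀ i j, ∀ v ∈ W, T i (T j v) - T j (T i v) ∈ Z) (v : V) (hv : v ∈ W) :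
    ∃ κ : MvPolynomial σ K →ₗ[K] V, (∀ Q, κ Q ∈ W) ∧ (κ 1 - v ∈ Z) ∧
      ∀ i Q, κ (MvPolynomial.X i * Q) - T i (κ Q) ∈ Z := by
  let Z' : Submodule K W := Z.comap W.subtype
  let T1 : σ → Module.End K W := fun i => (T i).restrict (hW i)
  have hT1 : ∀ i, Z' ≤ Z'.comap (T1 i) := fun i x hx => hZ i _ hx
  let T2 : σ → Module.End K (W ⧸ Z') := fun i => Z'.mapQ Z' (T1 i) (hT1 i)
  obtain ⟨A, hA⟩ := exists_polyHom T2 (by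
    intro i j
    ext x
    have : Z'.mkQ (T1 i (T1 j x)) = Z'.mkQ (T1 j (T1 i x)) := by
      rw [← sub_eq_zero, ← map_sub]
      simp only [Submodule.mkQ_apply, Submodule.Quotient.mk_eq_zero]
      exact hc i j x x.2
    exact this)
  obtain ⟨s, hs⟩ := Z'.mkQ.exists_rightInverse_of_surjective (Submodule.range_mkQ _)
  have hs' : ∀ x, Z'.mkQ (s x) = x := fun x => LinearMap.congr_fun hs x
  let κ : MvPolynomial σ K →ₗ[K] W := s ∘ₗ (LinearMap.applyₗ (Z'.mkQ ⟨v, hv⟩)) ∘ₗ A.toLinearMap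
  have hk : ∀ Q, Z'.mkQ (κ Q) = A Q (Z'.mkQ ⟨v, hv⟩) := fun Q => hs' _
  refine ⟨W.subtype ∘ₗ κ, fun Q => (κ Q).2, ?_, ?_⟩
  · have : Z'.mkQ (κ 1 - ⟨v, hv⟩) = 0 := by rw [map_sub, hk]; simp
    rw [Submodule.mkQ_apply, Submodule.Quotient.mk_eq_zero] at this
    exact this
  · intro i Q
    have : Z'.mkQ (κ (MvPolynomial.X i * Q) - T1 i (κ Q)) = 0 := by
      have h2 : Z'.mkQ (T1 i (κ Q)) = T2 i (Z'.mkQ (κ Q)) := rfl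
      rw [map_sub, hk, h2, hk, map_mul, hA, Module.End.mul_apply, sub_self]
    rw [Submodule.mkQ_apply, Submodule.Quotient.mk_eq_zero] at this
    exact this
end polyact

section kos
variable {K : Type*} [Field K] [CharZero K] {m : ℕ}
open MvPolynomial

abbrev PP (K : Type*) [Field K] (m : ℕ) := MvPolynomial (Fin m ⊕ Fin m) K

def yv (K : Type*) [Field K] {m : ℕ} (i : Fin m) : PP K m := X (Sum.inr i)
def wt (m : ℕ) : Fin m ⊕ Fin m → ℕ := Sum.elim (fun _ => 0) (fun _ => 1)
def pd (i : Fin m) : PP K m →ₗ[K] PP K m := (pderiv (Sum.inr i)).toLinearMap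
lemma pd_def (i : Fin m) (Q : PP K m) : pd i Q = pderiv (Sum.inr i) Q := rfl

def hcm (d : ℕ) : PP K m →ₗ[K] PP K m := weightedHomogeneousComponent (wt m) d

lemma hcm_hom (d : ℕ) (Q : PP K m) : IsWeightedHomogeneous (wt m) (hcm d Q) d :=
  by unfold hcm; apply weightedHomogeneousComponent_isWeightedHomogeneous

lemma exists_hcm_sum (Q : PP K m) : ∃ D : ℕ, ∀ D' ≥ D, Q = ∑ d ∈ Finset.range D', hcm d Q := by
  refine ⟨weightedTotalDegree (wt m) Q + 1, fun D' hD => ?_⟩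
  conv_lhs => rw [← finsum_weightedHomogeneousComponent (wt m) Q]
  rw [finsum_eq_sum_of_support_subset]
  · rfl
  · intro d hd
    simp only [Finset.coe_range, Set.mem_Iio]
    by_contra hcon
    exact hd (weightedHomogeneousComponent_eq_zero _ _ (by omega))

lemma hcm_mul (d k : ℕ) (Q h : PP K m) (hh : IsWeightedHomogeneous (wt m) h k) :
    hcm (d + k) (Q * h) = hcm d Q * h := by
  obtain ⟨D, hD⟩ := exists_hcm_sum Q
  have h1 := hD (max D (d+1)) (le_max_left _ _)
  conv_lhs => rw [h1]
  rw [Finset.sum_mul, map_sum, Finset.sum_eq_single d]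
  · exact ((hcm_hom d Q).mul hh).weightedHomogeneousComponent_same
  · intro e _ hed
    exact ((hcm_hom e Q).mul hh).weightedHomogeneousComponent_ne _ (by omega)
  · intro hcon
    exact absurd (Finset.mem_range.2 (lt_of_lt_of_le (Nat.lt_succ_self d) (le_max_right _ _))) hcon

lemma yv_hom (i : Fin m) : IsWeightedHomogeneous (wt m) (yv K i) 1 :=
  isWeightedHomogeneous_X _ _ (Sum.inr i)

lemma pd_mul (a : Fin m) (P Q : PP K m) : pd a (P * Q) = pd a P * Q + P * pd a Q := by
  simp only [pd_def, Derivation.leibniz, smul_eq_mul]; ring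
lemma pd_y (a i : Fin m) : pd a (yv K i) = if a = i then 1 else 0 := by
  simp only [pd_def, yv, pderiv_X, Pi.single_apply, Sum.inr.injEq, eq_comm]

lemma euler (Q : PP K m) (d : ℕ) (h : IsWeightedHomogeneous (wt m) Q d) :
    ∑ a, yv K a * pd a Q = (d : K) • Q := by
  have := h.sum_weight_X_mul_pderiv
  rw [Fintype.sum_sum_type] at this
  simp only [wt, Sum.elim_inl, zero_smul, Finset.sum_const_zero, Sum.elim_inr, one_smul,
    zero_add] at this
  rw [← Nat.cast_smul_eq_nsmul K] at this
  exact this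

lemma euler2 (Q : PP K m) (d : ℕ) (h : IsWeightedHomogeneous (wt m) Q d) :
    ∑ a, ∑ b, yv K a * (yv K b * pd a (pd b Q)) = ((d : K) * (d - 1)) • Q := by
  have h1 : ∀ a, ∑ b, yv K b * pd a (pd b Q) = ((d:K) - 1) • pd a Q := by
    intro a
    have := congrArg (pd a) (euler Q d h)
    rw [map_sum] at this
    simp only [pd_mul, pd_y, Finset.sum_add_distrib, ite_mul, one_mul, zero_mul, Finset.sum_ite_eq,
      Finset.mem_univ, if_true] at this
    have h2 : pd a ((d:K) • Q) = (d:K) • pd a Q := by simp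
    rw [h2] at this
    rw [sub_smul, one_smul, ← this]; ring
  have h2 : ∀ a, ∑ b, yv K a * (yv K b * pd a (pd b Q)) = ((d:K)-1) • (yv K a * pd a Q) := by
    intro a
    rw [← Finset.mul_sum, h1, mul_smul_comm]
  simp only [h2]
  rw [← Finset.smul_sum, euler Q d h, smul_smul, mul_comm]

def dl (i j : Fin m) (p : Fin m) : PP K m :=
  (if i = p then yv K j else 0) - (if j = p then yv K i else 0)

lemma dl_hom (i j p : Fin m) : IsWeightedHomogeneous (wt m) (dl (K := K) i j p) 1 := by
  unfold dl
  refine IsWeightedHomogeneous.sub ?_ ?_ <;> split_ifs <;>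
    first | exact yv_hom _ | exact isWeightedHomogeneous_zero _ _ _

variable {M : Type*} [AddCommGroup M] [Module K M]

lemma K1h (κ : Fin m → Fin m → PP K m →ₗ[K] M)
    (anti : ∀ i j Q, κ i j Q = - κ j i Q)
    (jac : ∀ i j a Q, κ i j (yv K a * Q) + κ j a (yv K i * Q) + κ a i (yv K j * Q) = 0)
    (Q : PP K m) (d : ℕ) (hQ : IsWeightedHomogeneous (wt m) Q d) (i j : Fin m) :
    ∑ k, ∑ l, κ k l (pd k (Q * dl i j l)) = (-((d:K)+2)) • κ i j Q := by
  have h1 : ∀ k, ∑ l, κ k l (pd k (Q * dl i j l))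
      = κ k i (pd k (Q * yv K j)) - κ k j (pd k (Q * yv K i)) := by
    intro k
    simp only [dl, mul_sub, mul_ite, mul_zero, map_sub, Finset.sum_sub_distrib,
      apply_ite (pd k), apply_ite (κ k _), map_zero, Finset.sum_ite_eq, Finset.mem_univ, if_true]
  have h2 : ∀ k, κ k i (pd k (Q * yv K j)) - κ k j (pd k (Q * yv K i))
     = - κ i j (yv K k * pd k Q) + ((if k = j then κ k i Q else 0) - (if k = i then κ k j Q else 0)) := by
    intro k
    have hj := jac i j k (pd k Q)
    rw [anti j k] at hj
    simp only [pd_mul, pd_y, mul_ite, mul_one, mul_zero, map_add, apply_ite (κ k _), map_zero]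
    rw [mul_comm (pd k Q), mul_comm (pd k Q)]
    linear_combination (norm := module) hj
  simp only [h1, h2, Finset.sum_add_distrib, Finset.sum_neg_distrib, Finset.sum_sub_distrib,
    Finset.sum_ite_eq', Finset.mem_univ, if_true]
  rw [← map_sum, euler Q d hQ, map_smul, anti j i]
  module

lemma homred {ι J : Type*} [Fintype ι] (κ : ι → PP K m →ₗ[K] M) (δ : ι → J → PP K m) (e : ℕ)
    (hδ : ∀ t p, IsWeightedHomogeneous (wt m) (δ t p) e) (S : Submodule K M)
    (step : ∀ (d : ℕ) (c : ι → PP K m), (∀ t, IsWeightedHomogeneous (wt m) (c t) d) →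
      (∀ p, ∑ t, c t * δ t p = 0) → ∑ t, κ t (c t) ∈ S)
    (c : ι → PP K m) (hc : ∀ p, ∑ t, c t * δ t p = 0) : ∑ t, κ t (c t) ∈ S := by
  have hd : ∀ d, ∑ t, κ t (hcm d (c t)) ∈ S := by
    intro d
    refine step d _ (fun t => hcm_hom _ _) (fun p => ?_)
    have := congrArg (hcm (d+e)) (hc p)
    simpa only [map_sum, map_zero, hcm_mul d e _ _ (hδ _ _)] using this
  choose D hD using fun i => exists_hcm_sum (c i)
  have hD' : ∀ i, ∑ i, D i ≥ D i := fun i =>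
    Finset.single_le_sum (f := fun j => D j) (fun _ _ => Nat.zero_le _) (Finset.mem_univ i)
  have : ∀ i, κ i (c i) = ∑ d ∈ Finset.range (∑ i, D i), κ i (hcm d (c i)) := by
    intro i
    rw [← map_sum, ← hD i _ (hD' i)]
  simp only [this]
  rw [Finset.sum_comm]
  exact Submodule.sum_mem _ fun d _ => hd d

lemma phi_zero {ι J : Type*} [Fintype ι] [Fintype J] (δ : ι → J → PP K m)
    (c : ι → PP K m) (hc : ∀ p, ∑ t, c t * δ t p = 0) (Φ : J → PP K m →ₗ[K] M) :
    ∑ t, ∑ p, Φ p (c t * δ t p) = 0 := by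
  rw [Finset.sum_comm]
  simp only [← map_sum, hc, map_zero, Finset.sum_const_zero]

lemma K1 (κ : Fin m → Fin m → PP K m →ₗ[K] M)
    (anti : ∀ i j Q, κ i j Q = - κ j i Q)
    (jac : ∀ i j a Q, κ i j (yv K a * Q) + κ j a (yv K i * Q) + κ a i (yv K j * Q) = 0)
    (c : Fin m × Fin m → PP K m)
    (hc : ∀ p, ∑ t, c t * dl t.1 t.2 p = 0) :
    ∑ t, κ t.1 t.2 (c t) = 0 := by
  rw [← Submodule.mem_bot K]
  refine homred (ι := Fin m × Fin m) (J := Fin m) (fun t => κ t.1 t.2) (fun t p => dl t.1 t.2 p) 1 (fun t p => dl_hom _ _ _) ⊥ ?_ c hc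
  intro d c hd hc
  have h1 := phi_zero _ c hc (fun l => ∑ k, κ k l ∘ₗ pd k)
  have h2 : ∀ t, ∑ p, (∑ k, κ k p ∘ₗ pd k) (c t * dl t.1 t.2 p)
      = (-((d:K)+2)) • κ t.1 t.2 (c t) := by
    intro t
    rw [← K1h κ anti jac _ d (hd t), Finset.sum_comm]
    simp
  simp only [h2, ← Finset.smul_sum] at h1
  rw [Submodule.mem_bot]
  refine (smul_eq_zero.1 h1).resolve_left ?_
  rw [neg_eq_zero]; exact_mod_cast (by omega : d + 2 ≠ 0)

lemma hexp (F : Fin m → Fin m → PP K m →ₗ[K] M) (Q : PP K m) (u v : Fin m) :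
    ∑ a, ∑ b, F a b (pd a (pd b (Q * yv K u * yv K v)))
    = ∑ a, ∑ b, F a b (yv K u * (yv K v * pd a (pd b Q)))
      + ∑ a, (F a u (yv K v * pd a Q) + F a v (yv K u * pd a Q))
      + ∑ b, (F u b (yv K v * pd b Q) + F v b (yv K u * pd b Q)) + F u v Q + F v u Q := by
  have h : ∀ a b, pd a (pd b (Q * yv K u * yv K v)) = yv K u * (yv K v * pd a (pd b Q))
     + (if b = u then yv K v * pd a Q else 0) + (if b = v then yv K u * pd a Q else 0)
     + (if a = u then yv K v * pd b Q else 0) + (if a = v then yv K u * pd b Q else 0)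
     + (if a = u then (if b = v then Q else 0) else 0)
     + (if a = v then (if b = u then Q else 0) else 0) := by
    intro a b
    simp only [pd_mul, pd_y, map_add]
    have e1 : pd a (if b = u then (1 : PP K m) else 0) = 0 := by
      split_ifs <;> simp [pd_def]
    have e2 : pd a (if b = v then (1 : PP K m) else 0) = 0 := by
      split_ifs <;> simp [pd_def]
    rw [e1, e2]
    split_ifs <;> ring
  have hif : ∀ (c : Prop) [Decidable c] (a b : Fin m) (x : PP K m),
      F a b (if c then x else 0) = if c then F a b x else 0 := by
    intro c _ a b x; split_ifs <;> simp
  simp only [h, map_add, hif, Finset.sum_add_distrib, Finset.sum_ite_eq', Finset.mem_univ, if_true]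
  have hif2 : ∀ (c : Prop) [Decidable c] (x : Fin m → M),
     (∑ b, if c then x b else 0) = if c then ∑ b, x b else 0 := by
    intro c _ x; split_ifs <;> simp
  simp only [hif2, Finset.sum_ite_eq', Finset.mem_univ, if_true]
  abel

/-- the alternating combination -/
def kw (κ : Fin m → Fin m → Fin m → Fin m → PP K m →ₗ[K] M) (i j k l : Fin m) : PP K m →ₗ[K] M :=
  κ i j k l + κ k l i j - κ k j i l + κ k i j l + κ l j i k - κ l i j k

lemma K2h (κ : Fin m → Fin m → Fin m → Fin m → PP K m →ₗ[K] M)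
    (anti1 : ∀ i j k l Q, κ i j k l Q = - κ j i k l Q)
    (anti2 : ∀ i j k l Q, κ i j k l Q = - κ i j l k Q)
    (jac1 : ∀ i j a k l Q, κ i j k l (yv K a * Q) + κ j a k l (yv K i * Q)
      + κ a i k l (yv K j * Q) = 0)
    (jac2 : ∀ i j k l a Q, κ i j k l (yv K a * Q) + κ i j l a (yv K k * Q)
      + κ i j a k (yv K l * Q) = 0)
    (Q : PP K m) (d : ℕ) (hQ : IsWeightedHomogeneous (wt m) Q d) (i j k l : Fin m) :
    ∑ p, ∑ q, ∑ a, ∑ b, κ a p b q (pd a (pd b (Q * (dl i j p * dl k l q))))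
      = (((d:K)+1)*(d+4) + 1) • κ i j k l Q + κ k l i j Q - kw κ i j k l Q := by
  have J1 : ∀ i j a k l Q, κ a j k l (yv K i * Q) - κ a i k l (yv K j * Q)
      = κ i j k l (yv K a * Q) := by
    intro i j a k l Q
    have := jac1 i j a k l Q
    rw [anti1 j a] at this
    linear_combination (norm := module) -this
  have J2 : ∀ i j k l a Q, κ i j a l (yv K k * Q) - κ i j a k (yv K l * Q)
      = κ i j k l (yv K a * Q) := by
    intro i j k l a Q
    have := jac2 i j k l a Q
    rw [anti2 i j l a] at this
    linear_combination (norm := module) -this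
  have hcol : ∑ p, ∑ q, ∑ a, ∑ b, κ a p b q (pd a (pd b (Q * (dl i j p * dl k l q))))
     = (∑ a, ∑ b, κ a i b k (pd a (pd b (Q * yv K j * yv K l)))
     - ∑ a, ∑ b, κ a i b l (pd a (pd b (Q * yv K j * yv K k))))
     - (∑ a, ∑ b, κ a j b k (pd a (pd b (Q * yv K i * yv K l)))
     - ∑ a, ∑ b, κ a j b l (pd a (pd b (Q * yv K i * yv K k)))) := by
    have g : ∀ (G : Fin m → Fin m → PP K m →ₗ[K] M), 
       ∑ p, ∑ q, G p q (Q * (dl i j p * dl k l q)) = (G i k (Q * yv K j * yv K l) -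
         G i l (Q * yv K j * yv K k)) - (G j k (Q * yv K i * yv K l) - G j l (Q * yv K i * yv K k)) := by
      intro G
      have hif : ∀ (c : Prop) [Decidable c] (a b : Fin m) (x : PP K m),
          G a b (if c then x else 0) = if c then G a b x else 0 := by
        intro c _ a b x; split_ifs <;> simp
      have hif2 : ∀ (c : Prop) [Decidable c] (x : Fin m → M),
         (∑ b, if c then x b else 0) = if c then ∑ b, x b else 0 := by
        intro c _ x; split_ifs <;> simp
      simp only [dl, mul_sub, sub_mul, mul_ite, mul_zero, ite_mul, zero_mul, map_sub, hif,
        Finset.sum_sub_distrib, Finset.sum_ite_eq, Finset.mem_univ, if_true, hif2, mul_assoc]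
      abel
    have := g (fun p q => ∑ a, ∑ b, κ a p b q ∘ₗ pd a ∘ₗ pd b)
    simpa only [LinearMap.sum_apply, LinearMap.comp_apply] using this
  rw [hcol, hexp (fun a b => κ a i b k), hexp (fun a b => κ a i b l), hexp (fun a b => κ a j b k),
    hexp (fun a b => κ a j b l)]
  -- the three sums
  have s1 : ∑ a, ∑ b, κ a i b k (yv K j * (yv K l * pd a (pd b Q)))
      - ∑ a, ∑ b, κ a i b l (yv K j * (yv K k * pd a (pd b Q)))
      - ∑ a, ∑ b, κ a j b k (yv K i * (yv K l * pd a (pd b Q)))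
      + ∑ a, ∑ b, κ a j b l (yv K i * (yv K k * pd a (pd b Q))) = ((d:K) * (d-1)) • κ i j k l Q := by
    rw [← map_smul, ← euler2 Q d hQ]
    simp only [map_sum, ← Finset.sum_sub_distrib, ← Finset.sum_add_distrib]
    refine Finset.sum_congr rfl fun a _ => Finset.sum_congr rfl fun b _ => ?_
    have e1 := J1 i j a b k (yv K l * pd a (pd b Q))
    have e2 := J1 i j a b l (yv K k * pd a (pd b Q))
    have e3 := J2 i j k l b (yv K a * pd a (pd b Q))
    simp only [mul_left_comm (yv K a)] at e1 e2 e3 ⊢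
    linear_combination (norm := module) e3 + e2 - e1
  have s2 : ∑ a, (κ a i j k (yv K l * pd a Q) + κ a i l k (yv K j * pd a Q))
      - ∑ a, (κ a i j l (yv K k * pd a Q) + κ a i k l (yv K j * pd a Q))
      - ∑ a, (κ a j i k (yv K l * pd a Q) + κ a j l k (yv K i * pd a Q))
      + ∑ a, (κ a j i l (yv K k * pd a Q) + κ a j k l (yv K i * pd a Q)) = (3 * (d:K)) • κ i j k l Q := by
    have : (3 * (d:K)) • κ i j k l Q = ∑ a, (3:K) • κ i j k l (yv K a * pd a Q) := by
      rw [mul_smul, ← map_smul, ← euler Q d hQ, map_sum, Finset.smul_sum]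
    rw [this]
    simp only [← Finset.sum_sub_distrib, ← Finset.sum_add_distrib]
    refine Finset.sum_congr rfl fun a _ => ?_
    have e1 := J2 a i k l j (pd a Q)
    have e2 := J2 a j k l i (pd a Q)
    have e3 := J1 i j a k l (pd a Q)
    have e4 := anti2 a i l k (yv K j * pd a Q)
    have e5 := anti2 a j l k (yv K i * pd a Q)
    linear_combination (norm := module) e4 - e5 - e1 + e2 + (3:K) • e3
  have s3 : ∑ b, (κ j i b k (yv K l * pd b Q) + κ l i b k (yv K j * pd b Q))
      - ∑ b, (κ j i b l (yv K k * pd b Q) + κ k i b l (yv K j * pd b Q))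
      - ∑ b, (κ i j b k (yv K l * pd b Q) + κ l j b k (yv K i * pd b Q))
      + ∑ b, (κ i j b l (yv K k * pd b Q) + κ k j b l (yv K i * pd b Q)) = (3 * (d:K)) • κ i j k l Q := by
    have : (3 * (d:K)) • κ i j k l Q = ∑ a, (3:K) • κ i j k l (yv K a * pd a Q) := by
      rw [mul_smul, ← map_smul, ← euler Q d hQ, map_sum, Finset.smul_sum]
    rw [this]
    simp only [← Finset.sum_sub_distrib, ← Finset.sum_add_distrib]
    refine Finset.sum_congr rfl fun a _ => ?_
    have e1 := J1 i j k a l (pd a Q)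
    have e2 := J1 i j l a k (pd a Q)
    have e3 := J2 i j k l a (pd a Q)
    have e4 := anti1 j i a k (yv K l * pd a Q)
    have e5 := anti1 j i a l (yv K k * pd a Q)
    linear_combination (norm := module) e4 - e5 + e1 - e2 + (3:K) • e3
  have a1 := anti1 j i l k Q
  have a2 := anti2 i j l k Q
  have a3 := anti1 j i k l Q
  have a4 := anti1 j k i l Q
  simp only [kw, LinearMap.add_apply, LinearMap.sub_apply]
  linear_combination (norm := module) s1 + s2 + s3 + a1 - (2:K) • a2 - a3
end kos

section kos2
variable {K : Type*} [Field K] [CharZero K] {m : ℕ}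
open MvPolynomial
variable {M : Type*} [AddCommGroup M] [Module K M]

lemma kw_y (κ : Fin m → Fin m → Fin m → Fin m → PP K m →ₗ[K] M)
    (anti1 : ∀ i j k l Q, κ i j k l Q = - κ j i k l Q)
    (anti2 : ∀ i j k l Q, κ i j k l Q = - κ i j l k Q)
    (jac1 : ∀ i j a k l Q, κ i j k l (yv K a * Q) + κ j a k l (yv K i * Q)
      + κ a i k l (yv K j * Q) = 0)
    (jac2 : ∀ i j k l a Q, κ i j k l (yv K a * Q) + κ i j l a (yv K k * Q)
      + κ i j a k (yv K l * Q) = 0)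
    (i j k l a : Fin m) (Q : PP K m) : kw κ i j k l (yv K a * Q) = 0 := by
  simp only [kw, LinearMap.add_apply, LinearMap.sub_apply]
  linear_combination (norm := module) jac2 i j k l a Q - jac2 i k j l a Q + jac2 i l j k a Q + jac1 j k l i a Q + jac2 j k i l a Q - jac2 j l i k a Q - jac1 i k l j a Q + jac2 k l i j a Q + jac1 i j l k a Q - jac1 i j k l a Q - anti1 k j i l (yv K a * Q) + anti1 k i j l (yv K a * Q) + anti1 l j i k (yv K a * Q) - anti1 l i j k (yv K a * Q) - anti1 l j i a (yv K k * Q) + anti1 l i j a (yv K k * Q) - anti1 l i k a (yv K j * Q) + anti1 k i l a (yv K j * Q) - anti2 i j a k (yv K l * Q) + anti2 i k a j (yv K l * Q) - anti2 i l a j (yv K k * Q) - anti2 j k a i (yv K l * Q) + anti2 j l a i (yv K k * Q) - anti2 k l a i (yv K j * Q)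

lemma K2hs (κ : Fin m → Fin m → Fin m → Fin m → PP K m →ₗ[K] M)
    (anti1 : ∀ i j k l Q, κ i j k l Q = - κ j i k l Q)
    (anti2 : ∀ i j k l Q, κ i j k l Q = - κ i j l k Q)
    (jac1 : ∀ i j a k l Q, κ i j k l (yv K a * Q) + κ j a k l (yv K i * Q)
      + κ a i k l (yv K j * Q) = 0)
    (jac2 : ∀ i j k l a Q, κ i j k l (yv K a * Q) + κ i j l a (yv K k * Q)
      + κ i j a k (yv K l * Q) = 0)
    (d : ℕ) (c : Fin m × Fin m × Fin m × Fin m → PP K m)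
    (hd : ∀ t, IsWeightedHomogeneous (wt m) (c t) d)
    (hc : ∀ p : Fin m × Fin m,
      ∑ t, c t * (dl t.1 t.2.1 p.1 * dl t.2.2.1 t.2.2.2 p.2) = 0) :
    (((d:K)+1)*(d+4) + 1) • ∑ t, κ t.1 t.2.1 t.2.2.1 t.2.2.2 (c t)
      + ∑ t, κ t.2.2.1 t.2.2.2 t.1 t.2.1 (c t)
      - ∑ t, kw κ t.1 t.2.1 t.2.2.1 t.2.2.2 (c t) = 0 := by
  have h1 := phi_zero (ι := Fin m × Fin m × Fin m × Fin m) (J := Fin m × Fin m)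
    (fun t p => dl t.1 t.2.1 p.1 * dl t.2.2.1 t.2.2.2 p.2) c hc
    (fun p => ∑ a, ∑ b, κ a p.1 b p.2 ∘ₗ pd a ∘ₗ pd b)
  rw [Finset.smul_sum, ← Finset.sum_add_distrib, ← Finset.sum_sub_distrib, ← h1]
  refine Finset.sum_congr rfl fun t _ => ?_
  rw [← K2h κ anti1 anti2 jac1 jac2 (c t) d (hd t), Fintype.sum_prod_type]
  simp only [LinearMap.sum_apply, LinearMap.comp_apply]

lemma K2 (κ : Fin m → Fin m → Fin m → Fin m → PP K m →ₗ[K] M)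
    (anti1 : ∀ i j k l Q, κ i j k l Q = - κ j i k l Q)
    (anti2 : ∀ i j k l Q, κ i j k l Q = - κ i j l k Q)
    (jac1 : ∀ i j a k l Q, κ i j k l (yv K a * Q) + κ j a k l (yv K i * Q)
      + κ a i k l (yv K j * Q) = 0)
    (jac2 : ∀ i j k l a Q, κ i j k l (yv K a * Q) + κ i j l a (yv K k * Q)
      + κ i j a k (yv K l * Q) = 0)
    (S : Submodule K M) (hS : ∀ i j k l Q, kw κ i j k l Q ∈ S)
    (c : Fin m × Fin m × Fin m × Fin m → PP K m)
    (hc : ∀ p : Fin m × Fin m,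
      ∑ t, c t * (dl t.1 t.2.1 p.1 * dl t.2.2.1 t.2.2.2 p.2) = 0) :
    ∑ t, κ t.1 t.2.1 t.2.2.1 t.2.2.2 (c t) ∈ S := by
  refine homred (ι := Fin m × Fin m × Fin m × Fin m) (J := Fin m × Fin m)
    (fun t => κ t.1 t.2.1 t.2.2.1 t.2.2.2)
    (fun t p => dl t.1 t.2.1 p.1 * dl t.2.2.1 t.2.2.2 p.2) 2
    (fun t p => (dl_hom _ _ _).mul (dl_hom _ _ _)) S ?_ c hc
  clear hc c
  intro d c hd hc
  have e1 := K2hs κ anti1 anti2 jac1 jac2 d c hd hc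
  have e2 := K2hs (fun i j k l => κ k l i j) (fun _ _ _ _ _ => anti2 _ _ _ _ _)
    (fun _ _ _ _ _ => anti1 _ _ _ _ _) (fun _ _ _ _ _ _ => jac2 _ _ _ _ _ _)
    (fun _ _ _ _ _ _ => jac1 _ _ _ _ _ _) d c hd hc
  have e3 : ∑ t : Fin m × Fin m × Fin m × Fin m, kw (fun i j k l => κ k l i j) t.1 t.2.1 t.2.2.1 t.2.2.2 (c t)
      = ∑ t : Fin m × Fin m × Fin m × Fin m, kw κ t.1 t.2.1 t.2.2.1 t.2.2.2 (c t) := by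
    refine Finset.sum_congr rfl fun t _ => ?_
    obtain ⟨i, j, k, l⟩ := t
    simp only [kw, LinearMap.add_apply, LinearMap.sub_apply]
    generalize c (i, j, k, l) = Q
    rw [anti2 i l k j, anti1 i l j k, anti1 j l k i, anti2 l j k i, anti1 i k l j, anti2 k i l j,
      anti1 j k l i, anti2 k j l i]
    module
  rw [e3] at e2
  have hw : ∑ t : Fin m × Fin m × Fin m × Fin m, kw κ t.1 t.2.1 t.2.2.1 t.2.2.2 (c t) ∈ S :=
    Submodule.sum_mem _ fun t _ => hS _ _ _ _ _
  set z := ∑ t : Fin m × Fin m × Fin m × Fin m, κ t.1 t.2.1 t.2.2.1 t.2.2.2 (c t)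
  set zs := ∑ t : Fin m × Fin m × Fin m × Fin m, κ t.2.2.1 t.2.2.2 t.1 t.2.1 (c t)
  set w := ∑ t : Fin m × Fin m × Fin m × Fin m, kw κ t.1 t.2.1 t.2.2.1 t.2.2.2 (c t)
  set C : K := ((d:K)+1)*(d+4) with hC
  have hC0 : C ≠ 0 := by rw [hC]; exact_mod_cast (by positivity : (d+1)*(d+4) ≠ 0)
  have hC2 : C + 2 ≠ 0 := by
    rw [hC]; exact_mod_cast (by positivity : (d+1)*(d+4)+2 ≠ 0)
  have : (C * (C+2)) • z = C • w := by
    linear_combination (norm := module) (C+1) • e1 - e2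
  have : z = (C+2)⁻¹ • w := by
    rw [eq_inv_smul_iff₀ hC2]
    rw [mul_smul] at this
    exact smul_right_injective _ hC0 this
  show z ∈ S
  rw [this]
  exact S.smul_mem _ hw
end kos2

section filt
variable (K : Type*) [Field K] {R : Type*} [Ring R] [Algebra K R]

/-- span of commutators -/
def BB (R : Type*) [Ring R] [Algebra K R] : Submodule K R :=
  Submodule.span K {x | ∃ a b : R, x = br a b}
/-- commutator ideal -/
def CI (R : Type*) [Ring R] [Algebra K R] : Submodule K R := ⊤ * BB K R * ⊤

lemma br_BB (a b : R) : br a b ∈ BB K R := Submodule.subset_span ⟨a, b, rfl⟩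
lemma tt : (⊤ : Submodule K R) * ⊤ = ⊤ := by
  refine top_le_iff.1 fun x _ => ?_
  rw [← one_mul x]; exact Submodule.mul_mem_mul trivial trivial

lemma ttCI : (⊤ : Submodule K R) * CI K R = CI K R := by
  rw [CI, ← mul_assoc, ← mul_assoc, tt]
lemma CItt : CI K R * (⊤ : Submodule K R) = CI K R := by
  rw [CI, mul_assoc, tt]
lemma ttCIn (n : ℕ) : (⊤ : Submodule K R) * CI K R ^ (n+1) = CI K R ^ (n+1) := by
  rw [pow_succ', ← mul_assoc, ttCI]
lemma CIntt (n : ℕ) : CI K R ^ (n+1) * (⊤ : Submodule K R) = CI K R ^ (n+1) := by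
  rw [pow_succ, mul_assoc, CItt]

variable {K}
lemma ml {n : ℕ} {x : R} (a : R) (h : x ∈ CI K R ^ (n+1)) : a * x ∈ CI K R ^ (n+1) := by
  rw [← ttCIn]; exact Submodule.mul_mem_mul trivial h
lemma mr {n : ℕ} {x : R} (a : R) (h : x ∈ CI K R ^ (n+1)) : x * a ∈ CI K R ^ (n+1) := by
  rw [← CIntt]; exact Submodule.mul_mem_mul h trivial
lemma ml1 {x : R} (a : R) (h : x ∈ CI K R) : a * x ∈ CI K R := by
  rw [← ttCI]; exact Submodule.mul_mem_mul trivial h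
lemma mr1 {x : R} (a : R) (h : x ∈ CI K R) : x * a ∈ CI K R := by
  rw [← CItt]; exact Submodule.mul_mem_mul h trivial
lemma m11 {x y : R} (h : x ∈ CI K R) (h' : y ∈ CI K R) : x * y ∈ CI K R ^ 2 := by
  rw [pow_two]; exact Submodule.mul_mem_mul h h'
lemma m12 {x y : R} (h : x ∈ CI K R) (h' : y ∈ CI K R ^ 2) : x * y ∈ CI K R ^ 3 := by
  rw [pow_succ']; exact Submodule.mul_mem_mul h h'
lemma m21 {x y : R} (h : x ∈ CI K R ^ 2) (h' : y ∈ CI K R) : x * y ∈ CI K R ^ 3 := by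
  rw [pow_succ]; exact Submodule.mul_mem_mul h h'
lemma BB_CI : BB K R ≤ CI K R := by
  intro x hx
  have h1 : (1:R) * x ∈ (⊤ : Submodule K R) * BB K R :=
    Submodule.mul_mem_mul Submodule.mem_top hx
  have h2 : (1:R) * x * 1 ∈ CI K R := Submodule.mul_mem_mul h1 Submodule.mem_top
  simpa using h2
lemma br_CI (a b : R) : br a b ∈ CI K R := BB_CI (br_BB K a b)
lemma CIle {n : ℕ} : CI K R ^ (n+2) ≤ CI K R ^ (n+1) := by
  rw [pow_succ, Submodule.mul_le]
  intro x hx y _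
  exact mr y hx

lemma CI_eq : CI K R = ⊤ * BB K R := by
  apply le_antisymm
  · rw [CI, Submodule.mul_le]
    intro y hy d _
    refine Submodule.mul_induction_on hy ?_ ?_
    · intro a _ x hx
      have : a * x * d = (a * d) * x + a * br x d := by unfold br; noncomm_ring
      rw [this]
      exact add_mem (Submodule.mul_mem_mul trivial hx) (Submodule.mul_mem_mul trivial (br_BB K _ _))
    · intro a b ha hb; rw [add_mul]; exact add_mem ha hb
  · rw [Submodule.mul_le]
    intro a _ b hb
    exact ml1 a (BB_CI hb)

/-- squares are central modulo cubes -/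
lemma CI2_eq : CI K R ^ 2 = ⊤ * (BB K R * BB K R) := by
  apply le_antisymm
  · rw [pow_two]
    nth_rewrite 2 [CI_eq]
    rw [← mul_assoc, CItt, CI_eq, mul_assoc]
  · rw [Submodule.mul_le]
    intro a _ b hb
    refine ml a ?_
    rw [pow_two]
    exact (mul_le_mul' BB_CI BB_CI) hb

lemma comm3 (H : HH R) {c : R} (hc : c ∈ CI K R ^ 2) (e : R) : br c e ∈ CI K R ^ 3 := by
  rw [CI2_eq] at hc
  refine Submodule.mul_induction_on hc ?_ ?_
  · intro u _ z hz
    have hz2 : z ∈ CI K R ^ 2 := by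
      rw [pow_two]; exact (mul_le_mul' BB_CI BB_CI) hz
    have hcen : z * e = e * z := by
      refine Submodule.mul_induction_on hz ?_ ?_
      · intro x hx y hy
        induction hx using Submodule.span_induction with
        | mem x hx =>
          obtain ⟨a, b, rfl⟩ := hx
          induction hy using Submodule.span_induction with
          | mem y hy => obtain ⟨c, d, rfl⟩ := hy; exact H _ _ _ _ _
          | zero => simp
          | add x y _ _ h1 h2 => rw [mul_add, add_mul, mul_add, h1, h2]
          | smul t x _ h => simp [h]
        | zero => simp
        | add x y _ _ h1 h2 => rw [add_mul, add_mul, mul_add, h1, h2]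
        | smul t x _ h => simp [h]
      · intro x y hx hy; rw [add_mul, mul_add, hx, hy]
    have : br (u * z) e = br u e * z := by
      unfold br; rw [mul_assoc, hcen]; noncomm_ring
    rw [this]
    exact m12 (br_CI _ _) hz2
  · intro x y hx hy
    have : br (x+y) e = br x e + br y e := by unfold br; noncomm_ring
    rw [this]; exact add_mem hx hy

section gen
variable {m : ℕ} (X : Fin m → R) (hX : Algebra.adjoin K (Set.range X) = ⊤)
include hX

lemma gen_left (S : Submodule K R) (h : ∀ a, ∀ s ∈ S, X a * s ∈ S) (r : R) : ∀ s ∈ S, r * s ∈ S := by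
  have hr : r ∈ Algebra.adjoin K (Set.range X) := by rw [hX]; trivial
  induction hr using Algebra.adjoin_induction with
  | mem x hx => obtain ⟨a, rfl⟩ := hx; exact h a
  | algebraMap t => intro s hs; rw [← Algebra.smul_def]; exact S.smul_mem _ hs
  | add x y _ _ h1 h2 => intro s hs; rw [add_mul]; exact add_mem (h1 s hs) (h2 s hs)
  | mul x y _ _ h1 h2 => intro s hs; rw [mul_assoc]; exact h1 _ (h2 s hs)

lemma gen_right (S : Submodule K R) (h : ∀ a, ∀ s ∈ S, s * X a ∈ S) (r : R) : ∀ s ∈ S, s * r ∈ S := by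
  have hr : r ∈ Algebra.adjoin K (Set.range X) := by rw [hX]; trivial
  induction hr using Algebra.adjoin_induction with
  | mem x hx => obtain ⟨a, rfl⟩ := hx; exact h a
  | algebraMap t => intro s hs; rw [← Algebra.commutes, ← Algebra.smul_def]; exact S.smul_mem _ hs
  | add x y _ _ h1 h2 => intro s hs; rw [mul_add]; exact add_mem (h1 s hs) (h2 s hs)
  | mul x y _ _ h1 h2 => intro s hs; rw [← mul_assoc]; exact h2 _ (h1 s hs)

/-- commutators from generators: `P` is closed under the product rule -/
lemma gen_br (P : R → R → Prop) (hs : ∀ a b, P a b → P b a)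
    (h1 : ∀ t b, P (algebraMap K R t) b) (ha : ∀ a a' b, P a b → P a' b → P (a + a') b)
    (hm : ∀ a a' b, P a b → P a' b → P (a * a') b)
    (hg : ∀ i j, P (X i) (X j)) (a b : R) : P a b := by
  have key : ∀ b, (∀ i, P (X i) b) → ∀ a, P a b := by
    intro b hb a
    have hr : a ∈ Algebra.adjoin K (Set.range X) := by rw [hX]; trivial
    induction hr using Algebra.adjoin_induction with
    | mem x hx => obtain ⟨i, rfl⟩ := hx; exact hb i
    | algebraMap t => exact h1 t b
    | add x y _ _ h1 h2 => exact ha _ _ _ h1 h2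
    | mul x y _ _ h1 h2 => exact hm _ _ _ h1 h2
  refine key b (fun i => hs _ _ ?_) a
  exact key (X i) (fun j => hg j i) b
end gen

end filt

section eqv
variable {K : Type*} [Field K] {σ V : Type*} [AddCommGroup V] [Module K V]
open MvPolynomial

/-- equivariance modulo `Z` -/
def Eqv (T : σ → Module.End K V) (Z : Submodule K V) (φ : MvPolynomial σ K →ₗ[K] V) : Prop :=
  ∀ i Q, φ (X i * Q) - T i (φ Q) ∈ Z

lemma Eqv.add {T : σ → Module.End K V} {Z : Submodule K V} {φ ψ : MvPolynomial σ K →ₗ[K] V}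
    (h : Eqv T Z φ) (h' : Eqv T Z ψ) : Eqv T Z (φ + ψ) := by
  intro i Q
  have := add_mem (h i Q) (h' i Q)
  simp only [LinearMap.add_apply, map_add]
  convert this using 1; abel

lemma Eqv.mulP {T : σ → Module.End K V} {Z : Submodule K V} {φ : MvPolynomial σ K →ₗ[K] V}
    (h : Eqv T Z φ) (P : MvPolynomial σ K) : Eqv T Z (φ ∘ₗ LinearMap.mulLeft K P) := by
  intro i Q
  have := h i (P * Q)
  simpa only [LinearMap.comp_apply, LinearMap.mulLeft_apply, mul_left_comm P] using this

lemma poly_ind (S : Submodule K (MvPolynomial σ K)) (h1 : 1 ∈ S) (hX : ∀ i, ∀ Q ∈ S, X i * Q ∈ S)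
    (Q : MvPolynomial σ K) : Q ∈ S := by
  induction Q using MvPolynomial.induction_on with
  | C a => rw [← mul_one (C a), ← MvPolynomial.smul_eq_C_mul]; exact S.smul_mem _ h1
  | add p q hp hq => exact add_mem hp hq
  | mul_X p i hp => rw [mul_comm]; exact hX i p hp

lemma Eqv.zero {T : σ → Module.End K V} {Z : Submodule K V} {φ : MvPolynomial σ K →ₗ[K] V}
    (h : Eqv T Z φ) (hZ : ∀ i, ∀ v ∈ Z, T i v ∈ Z) (h1 : φ 1 ∈ Z) (Q : MvPolynomial σ K) :
    φ Q ∈ Z := by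
  refine poly_ind (Z.comap φ) h1 (fun i Q hQ => ?_) Q
  have := add_mem (h i Q) (hZ i _ hQ)
  simpa using this
end eqv

section levels
variable {K : Type*} [Field K] [CharZero K] {R : Type*} [Ring R] [Algebra K R]
variable {m : ℕ} (X : Fin m → R) (hX : Algebra.adjoin K (Set.range X) = ⊤) (H : HH R)
open MvPolynomial (C)

lemma level0 (hX : Algebra.adjoin K (Set.range X) = ⊤) (ab : R →ₐ[K] MvPolynomial (Fin m) K)
    (hab : ∀ a, ab (X a) = MvPolynomial.X a) (r : R) (hr : ab r = 0) : r ∈ CI K R := by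
  obtain ⟨κ, -, h1, hs⟩ := exists_polyAct (K := K) (fun a => LinearMap.mulLeft K (X a)) ⊤ (CI K R)
    (fun _ _ _ => trivial) (fun a v hv => ml1 _ hv) (fun i j v _ => by
      simp only [LinearMap.mulLeft_apply]
      have : X i * (X j * v) - X j * (X i * v) = br (X i) (X j) * v := by unfold br; noncomm_ring
      rw [this]; exact mr1 _ (br_CI _ _)) (1 : R) trivial
  simp only [LinearMap.mulLeft_apply] at hs
  have hz : ∀ v ∈ CI K R, ab v = 0 := by
    intro v hv
    have : CI K R ≤ LinearMap.ker ab.toLinearMap := by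
      rw [CI_eq, Submodule.mul_le]
      intro a _ b hb
      rw [LinearMap.mem_ker, AlgHom.toLinearMap_apply, map_mul]
      have : BB K R ≤ LinearMap.ker ab.toLinearMap := by
        rw [BB, Submodule.span_le]
        rintro _ ⟨a, b, rfl⟩
        simp [br, mul_comm]
      rw [show ab b = 0 from this hb, mul_zero]
    exact this hv
  have hk : ∀ Q, ab (κ Q) = Q := by
    intro Q
    refine poly_ind (LinearMap.ker (ab.toLinearMap ∘ₗ κ - LinearMap.id)) ?_ ?_ Q |> fun h => by
      simpa [sub_eq_zero] using h
    · have := hz _ h1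
      simpa [sub_eq_zero] using this
    · intro i Q hQ
      have := hz _ (hs i Q)
      simp [sub_eq_zero, hab] at this hQ ⊢
      rw [this, hQ]
  have hall : ∀ r : R, r ∈ LinearMap.range κ ⊔ CI K R := by
    intro r
    rw [← mul_one r]
    refine gen_left X hX _ ?_ r 1 ?_
    · intro a s hs'
      obtain ⟨_, ⟨Q, rfl⟩, z, hz, rfl⟩ := Submodule.mem_sup.1 hs'
      rw [mul_add]
      refine add_mem ?_ (Submodule.mem_sup_right (ml1 _ hz))
      have e : X a * κ Q = κ (MvPolynomial.X a * Q) - (κ (MvPolynomial.X a * Q) - X a * κ Q) := by abel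
      rw [e]
      exact sub_mem (Submodule.mem_sup_left ⟨_, rfl⟩) (Submodule.mem_sup_right (hs a Q))
    · have e : (1:R) = κ 1 - (κ 1 - 1) := by abel
      rw [e]
      exact sub_mem (Submodule.mem_sup_left ⟨_, rfl⟩) (Submodule.mem_sup_right h1)
  obtain ⟨_, ⟨Q, rfl⟩, z, hz', rfl⟩ := Submodule.mem_sup.1 (hall r)
  rw [map_add, hk, hz z hz', add_zero] at hr
  rw [hr, map_zero, zero_add]; exact hz'

/-- operators on level 1 -/
def TT : Fin m ⊕ Fin m → Module.End K R :=
  Sum.elim (fun a => LinearMap.mulLeft K (X a))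
    (fun a => LinearMap.mulRight K (X a) - LinearMap.mulLeft K (X a))

lemma TT_inl (a : Fin m) (v : R) : TT (K := K) X (Sum.inl a) v = X a * v := rfl
lemma TT_inr (a : Fin m) (v : R) : TT (K := K) X (Sum.inr a) v = br v (X a) := rfl

lemma TT_mem (n : ℕ) (s : Fin m ⊕ Fin m) (v : R) (hv : v ∈ CI K R ^ (n+1)) :
    TT (K := K) X s v ∈ CI K R ^ (n+1) := by
  rcases s with a | a
  · exact ml _ hv
  · exact sub_mem (mr _ hv) (ml _ hv)

lemma exk1 : ∃ κ : Fin m → Fin m → PP K m →ₗ[K] R, (∀ i j Q, κ i j Q ∈ CI K R) ∧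
    (∀ i j, κ i j 1 - br (X i) (X j) ∈ CI K R ^ 2) ∧
    ∀ i j, Eqv (TT (K := K) X) (CI K R ^ 2) (κ i j) := by
  have := fun i j => exists_polyAct (K := K) (TT (K := K) X) (CI K R) (CI K R ^ 2)
    (fun s v hv => by simpa using TT_mem X 0 s v (by simpa using hv))
    (fun s v hv => TT_mem X 1 s v hv)
    (by
      rintro (a | a) (b | b) v hv
      · simp only [TT_inl]
        have : X a * (X b * v) - X b * (X a * v) = br (X a) (X b) * v := by unfold br; noncomm_ring
        rw [this]; exact m11 (br_CI _ _) hv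
      · simp only [TT_inl, TT_inr]
        have : X a * br v (X b) - br (X a * v) (X b) = - (br (X a) (X b) * v) := by
          unfold br; noncomm_ring
        rw [this]; exact neg_mem (m11 (br_CI _ _) hv)
      · simp only [TT_inl, TT_inr]
        have : br (X b * v) (X a) - X b * br v (X a) =  (br (X b) (X a) * v) := by
          unfold br; noncomm_ring
        rw [this]; exact (m11 (br_CI _ _) hv)
      · simp only [TT_inr]
        have : br (br v (X b)) (X a) - br (br v (X a)) (X b)
            =  v * br (X b) (X a) - br (X b) (X a) * v := by
          unfold br; noncomm_ring
        rw [this]; exact sub_mem (m11 hv (br_CI _ _)) (m11 (br_CI _ _) hv))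
    (br (X i) (X j)) (br_CI _ _)
  choose κ h1 h2 h3 using this
  exact ⟨κ, h1, h2, h3⟩

section withk
variable (κ : Fin m → Fin m → PP K m →ₗ[K] R) (k1 : ∀ i j Q, κ i j Q ∈ CI K R)
    (k2 : ∀ i j, κ i j 1 - br (X i) (X j) ∈ CI K R ^ 2)
    (k3 : ∀ i j, Eqv (TT (K := K) X) (CI K R ^ 2) (κ i j))

include k2 k3 in
lemma k_anti (i j : Fin m) (Q : PP K m) : κ i j Q + κ j i Q ∈ CI K R ^ 2 := by
  refine ((k3 i j).add (k3 j i)).zero (TT_mem X 1) ?_ Q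
  have := add_mem (k2 i j) (k2 j i)
  rw [br_swap (X j)] at this
  simpa using this

include k2 k3 in
lemma k_y1 (i j a : Fin m) : κ i j (yv K a) - br (br (X i) (X j)) (X a) ∈ CI K R ^ 2 := by
  have h1 := k3 i j (Sum.inr a) 1
  have h2 := TT_mem (K := K) X 1 (Sum.inr a) _ (k2 i j)
  rw [map_sub] at h2
  have := add_mem h1 h2
  rw [mul_one] at this
  simpa [TT_inr, yv] using this

include k2 k3 in
lemma k_jac (i j a : Fin m) (Q : PP K m) :
    κ i j (yv K a * Q) + κ j a (yv K i * Q) + κ a i (yv K j * Q) ∈ CI K R ^ 2 := by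
  refine ((((k3 i j).mulP (yv K a)).add ((k3 j a).mulP (yv K i))).add
    ((k3 a i).mulP (yv K j))).zero (TT_mem X 1) ?_ Q
  have := add_mem (add_mem (k_y1 X κ k2 k3 i j a) (k_y1 X κ k2 k3 j a i)) (k_y1 X κ k2 k3 a i j)
  simp only [LinearMap.add_apply, LinearMap.comp_apply, LinearMap.mulLeft_apply, mul_one]
  convert this using 1
  unfold br; noncomm_ring

/-- span of level one -/
def D1 : Submodule K R := (⨆ t : Fin m × Fin m, LinearMap.range (κ t.1 t.2)) ⊔ CI K R ^ 2

lemma D1_k (i j : Fin m) (Q : PP K m) : κ i j Q ∈ D1 κ :=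
  Submodule.mem_sup_left (Submodule.mem_iSup_of_mem (i, j) ⟨Q, rfl⟩)

include k3 in
lemma D1_T (s : Fin m ⊕ Fin m) : ∀ v ∈ D1 κ, TT (K := K) X s v ∈ D1 κ := by
  show D1 κ ≤ (D1 κ).comap (TT (K := K) X s)
  refine sup_le (iSup_le ?_) ?_
  · rintro ⟨i, j⟩ _ ⟨Q, rfl⟩
    have h := sub_mem (D1_k κ i j (MvPolynomial.X s * Q))
      (Submodule.mem_sup_right (k3 i j s Q) : _ ∈ D1 κ)
    simpa using h
  · intro v hv
    exact Submodule.mem_sup_right (TT_mem X 1 s v hv)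

include hX k2 k3 in
lemma D1_CI : CI K R ≤ D1 κ := by
  have hl : ∀ r : R, ∀ s ∈ D1 κ, r * s ∈ D1 κ :=
    gen_left X hX _ fun a s hs => D1_T X κ k3 (Sum.inl a) s hs
  have hr : ∀ r : R, ∀ s ∈ D1 κ, s * r ∈ D1 κ := by
    refine gen_right X hX _ fun a s hs => ?_
    have := add_mem (D1_T X κ k3 (Sum.inl a) s hs) (D1_T X κ k3 (Sum.inr a) s hs)
    rw [TT_inl, TT_inr, br] at this
    simpa using this
  rw [CI_eq, Submodule.mul_le]
  intro a _ b hb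
  refine hl a b ?_
  refine (Submodule.span_le.2 ?_ : BB K R ≤ D1 κ) hb
  rintro _ ⟨a, b, rfl⟩
  refine gen_br X hX (fun a b => br a b ∈ D1 κ) ?_ ?_ ?_ ?_ ?_ a b
  · intro a b h; rw [br_swap]; exact neg_mem h
  · intro t b; rw [br, Algebra.commutes, sub_self]; exact zero_mem _
  · intro a a' b h h'
    have : br (a + a') b = br a b + br a' b := by unfold br; noncomm_ring
    rw [this]; exact add_mem h h'
  · intro a a' b h h'
    have : br (a * a') b = br a b * a' + a * br a' b := by unfold br; noncomm_ring
    rw [this]; exact add_mem (hr _ _ h) (hl _ _ h')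
  · intro i j
    have h := sub_mem (D1_k κ i j 1) (Submodule.mem_sup_right (k2 i j) : _ ∈ D1 κ)
    simpa using h

lemma exists_sum {ι : Type*} [Fintype ι] {P : Type*} [AddCommGroup P] [Module K P]
    (f : ι → P →ₗ[K] R) (Z : Submodule K R) (r : R)
    (h : r ∈ (⨆ t, LinearMap.range (f t)) ⊔ Z) : ∃ c : ι → P, r - ∑ t, f t (c t) ∈ Z := by
  classical
  obtain ⟨u, hu, z, hz, rfl⟩ := Submodule.mem_sup.1 h
  obtain ⟨g, hg, rfl⟩ := (Submodule.mem_iSup_iff_exists_finsupp _ _).1 hu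
  choose c hc using hg
  refine ⟨c, ?_⟩
  rw [Finsupp.sum_fintype _ _ (fun _ => rfl)]
  simp only [hc]
  simpa using hz

include hX k1 k2 k3 in
lemma level1' (F : Fin m → R →ₗ[K] PP K m) (hF : ∀ p, ∀ v ∈ CI K R ^ 2, F p v = 0)
    (hk : ∀ p i j Q, F p (κ i j Q) = Q * dl i j p) (r : R) (hr : r ∈ CI K R)
    (h0 : ∀ p, F p r = 0) : r ∈ CI K R ^ 2 := by
  obtain ⟨c, hc⟩ := exists_sum (fun t : Fin m × Fin m => κ t.1 t.2) _ r (D1_CI X hX κ k2 k3 hr)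
  have hmk : ∀ x : R, x ∈ CI K R ^ 2 → (CI K R ^ 2).mkQ x = 0 := fun x hx => by
    rw [Submodule.mkQ_apply, Submodule.Quotient.mk_eq_zero]; exact hx
  have := K1 (fun i j => (CI K R ^ 2).mkQ ∘ₗ κ i j)
    (fun i j Q => by
      rw [eq_neg_iff_add_eq_zero]
      simpa only [LinearMap.comp_apply, map_add] using hmk _ (k_anti X κ k2 k3 i j Q))
    (fun i j a Q => by
      simpa only [LinearMap.comp_apply, map_add] using hmk _ (k_jac X κ k2 k3 i j a Q)) c
    (fun p => by
      have := hF p _ hc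
      rw [map_sub, h0, map_sum, zero_sub, neg_eq_zero] at this
      simpa only [hk] using this)
  simp only [LinearMap.comp_apply, ← map_sum] at this
  rw [Submodule.mkQ_apply, Submodule.Quotient.mk_eq_zero] at this
  simpa using add_mem hc this
end withk
end levels

section levels2
variable {K : Type*} [Field K] [CharZero K] {R : Type*} [Ring R] [Algebra K R]
variable {m : ℕ} (X : Fin m → R) (hX : Algebra.adjoin K (Set.range X) = ⊤) (H : HH R)

/-- alternating element of degree four -/
def ww (a b c d : R) : R := br a b * br c d + br c d * br a b - br c b * br a d + br c a * br b d
  + br d b * br a c - br d a * br b c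

/-- level two maps -/
def k4 (κ : Fin m → Fin m → PP K m →ₗ[K] R) (i j k l : Fin m) : PP K m →ₗ[K] R :=
  LinearMap.mulRight K (br (X k) (X l)) ∘ₗ κ i j

lemma k4_apply (κ : Fin m → Fin m → PP K m →ₗ[K] R) (i j k l : Fin m) (Q : PP K m) :
  k4 X κ i j k l Q = κ i j Q * br (X k) (X l) := rfl

variable (κ : Fin m → Fin m → PP K m →ₗ[K] R) (k1 : ∀ i j Q, κ i j Q ∈ CI K R)
    (k2 : ∀ i j, κ i j 1 - br (X i) (X j) ∈ CI K R ^ 2)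
    (k3 : ∀ i j, Eqv (TT (K := K) X) (CI K R ^ 2) (κ i j))

include k2 k3 in
lemma k4_anti1 (i j k l : Fin m) (Q : PP K m) : k4 X κ i j k l Q + k4 X κ j i k l Q ∈ CI K R ^ 3 := by
  rw [k4_apply, k4_apply, ← add_mul]
  exact m21 (k_anti X κ k2 k3 i j Q) (br_CI _ _)

lemma k4_anti2 (i j k l : Fin m) (Q : PP K m) : k4 X κ i j k l Q + k4 X κ i j l k Q ∈ CI K R ^ 3 := by
  rw [k4_apply, k4_apply, ← mul_add, br_swap (X l)]
  simp

include k2 k3 in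
lemma k4_jac1 (i j a k l : Fin m) (Q : PP K m) :
    k4 X κ i j k l (yv K a * Q) + k4 X κ j a k l (yv K i * Q) + k4 X κ a i k l (yv K j * Q)
      ∈ CI K R ^ 3 := by
  simp only [k4_apply, ← add_mul]
  exact m21 (k_jac X κ k2 k3 i j a Q) (br_CI _ _)

include H k1 k3 in
lemma k4_y (i j k l a : Fin m) (Q : PP K m) :
    k4 X κ i j k l (yv K a * Q) + κ i j Q * br (br (X k) (X l)) (X a) ∈ CI K R ^ 3 := by
  rw [k4_apply]
  have h1 := m21 (k3 i j (Sum.inr a) Q) (br_CI (K := K) (X k) (X l))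
  have h2 := comm3 (K := K) H (m11 (k1 i j Q) (br_CI (K := K) (X k) (X l))) (X a)
  have := add_mem h1 h2
  convert this using 1
  rw [TT_inr, yv]
  unfold br; noncomm_ring

include H k1 k3 in
lemma k4_jac2 (i j k l a : Fin m) (Q : PP K m) :
    k4 X κ i j k l (yv K a * Q) + k4 X κ i j l a (yv K k * Q) + k4 X κ i j a k (yv K l * Q)
      ∈ CI K R ^ 3 := by
  have := add_mem (add_mem (k4_y X H κ k1 k3 i j k l a Q) (k4_y X H κ k1 k3 i j l a k Q))
    (k4_y X H κ k1 k3 i j a k l Q)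
  convert this using 1
  have : br (br (X k) (X l)) (X a) + br (br (X l) (X a)) (X k) + br (br (X a) (X k)) (X l) = 0 := by
    unfold br; noncomm_ring
  have h2 : κ i j Q * br (br (X k) (X l)) (X a) + κ i j Q * br (br (X l) (X a)) (X k)
    + κ i j Q * br (br (X a) (X k)) (X l) = 0 := by rw [← mul_add, ← mul_add, this, mul_zero]
  rw [← sub_eq_zero, ← neg_eq_zero, ← h2]
  abel

/-- span of level two -/
def D2 : Submodule K R := (⨆ t : Fin m × Fin m × Fin m × Fin m,
  LinearMap.range (k4 X κ t.1 t.2.1 t.2.2.1 t.2.2.2)) ⊔ CI K R ^ 3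

lemma D2_k (i j k l : Fin m) (Q : PP K m) : k4 X κ i j k l Q ∈ D2 X κ :=
  Submodule.mem_sup_left (Submodule.mem_iSup_of_mem (i, j, k, l) ⟨Q, rfl⟩)

include k3 in
lemma k4_x (i j k l a : Fin m) (Q : PP K m) :
    k4 X κ i j k l (MvPolynomial.X (Sum.inl a) * Q) - X a * k4 X κ i j k l Q ∈ CI K R ^ 3 := by
  have h1 := m21 (k3 i j (Sum.inl a) Q) (br_CI (K := K) (X k) (X l))
  rw [k4_apply, k4_apply, ← mul_assoc, ← sub_mul]; exact h1

include hX k3 in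
lemma D2_l (r : R) : ∀ v ∈ D2 X κ, r * v ∈ D2 X κ := by
  refine gen_left X hX _ (fun a => ?_) r
  show D2 X κ ≤ (D2 X κ).comap (LinearMap.mulLeft K (X a))
  refine sup_le (iSup_le ?_) ?_
  · rintro ⟨i, j, k, l⟩ _ ⟨Q, rfl⟩
    have h := sub_mem (D2_k X κ i j k l (MvPolynomial.X (Sum.inl a) * Q))
      (Submodule.mem_sup_right (k4_x X κ k3 i j k l a Q) : _ ∈ D2 X κ)
    simpa using h
  · intro v hv
    exact Submodule.mem_sup_right (ml _ hv)

include H hX k2 k3 in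
lemma D2_CI : CI K R ^ 2 ≤ D2 X κ := by
  have key : ∀ a b : R, ∀ c ∈ CI K R, c * br a b ∈ D2 X κ := by
    refine gen_br X hX (fun a b => ∀ c ∈ CI K R, c * br a b ∈ D2 X κ) ?_ ?_ ?_ ?_ ?_
    · intro a b h c hc; rw [br_swap, mul_neg]; exact neg_mem (h c hc)
    · intro t b c _; rw [br, Algebra.commutes, sub_self, mul_zero]; exact zero_mem _
    · intro a a' b h h' c hc
      have : c * br (a + a') b = c * br a b + c * br a' b := by unfold br; noncomm_ring
      rw [this]; exact add_mem (h c hc) (h' c hc)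
    · intro a a' b h h' c hc
      have : c * br (a * a') b = a' * (c * br a b) + br (c * br a b) a' + (c * a) * br a' b := by
        unfold br; noncomm_ring
      rw [this]
      refine add_mem (add_mem (D2_l X hX κ k3 _ _ (h c hc)) (Submodule.mem_sup_right ?_))
        (h' _ (mr1 _ hc))
      exact comm3 H (m11 hc (br_CI _ _)) _
    · intro k l c hc
      have : CI K R ≤ (D2 X κ).comap (LinearMap.mulRight K (br (X k) (X l))) := by
        refine (D1_CI X hX κ k2 k3).trans (sup_le (iSup_le ?_) ?_)
        · rintro ⟨i, j⟩ _ ⟨Q, rfl⟩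
          exact D2_k X κ i j k l Q
        · intro v hv
          exact Submodule.mem_sup_right (m21 hv (br_CI _ _))
      exact this hc
  rw [pow_two]
  nth_rewrite 2 [CI_eq]
  rw [← mul_assoc, CItt, Submodule.mul_le]
  intro c hc b hb
  refine (Submodule.span_le.2 ?_ : BB K R ≤ (D2 X κ).comap (LinearMap.mulLeft K c)) hb
  rintro _ ⟨a, b, rfl⟩
  exact key a b c hc

/-- span of the alternating elements -/
def SW : Submodule K R := ⊤ * Submodule.span K {x | ∃ i j k l, x = ww (X i) (X j) (X k) (X l)}

include H hX k1 k2 k3 in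
lemma level2' (F : Fin m × Fin m → R →ₗ[K] PP K m) (hF : ∀ p, ∀ v ∈ CI K R ^ 3, F p v = 0)
    (hk : ∀ p i j k l Q, F p (κ i j Q * br (X k) (X l)) = -(Q * (dl i j p.1 * dl k l p.2))) (r : R)
    (hr : r ∈ CI K R ^ 2)
    (h0 : ∀ p, F p r = 0) : r ∈ SW (K := K) X ⊔ CI K R ^ 3 := by
  obtain ⟨c, hc⟩ := exists_sum (fun t : Fin m × Fin m × Fin m × Fin m =>
    k4 X κ t.1 t.2.1 t.2.2.1 t.2.2.2) _ r (D2_CI X hX H κ k2 k3 hr)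
  have hmk : ∀ x : R, x ∈ CI K R ^ 3 → (CI K R ^ 3).mkQ x = 0 := fun x hx => by
    rw [Submodule.mkQ_apply, Submodule.Quotient.mk_eq_zero]; exact hx
  let κ' := fun i j k l => (CI K R ^ 3).mkQ ∘ₗ k4 X κ i j k l
  have hκ' : ∀ i j k l Q, κ' i j k l Q = (CI K R ^ 3).mkQ (k4 X κ i j k l Q) := fun _ _ _ _ _ => rfl
  have anti1 : ∀ i j k l Q, κ' i j k l Q = - κ' j i k l Q := fun i j k l Q => by
    rw [eq_neg_iff_add_eq_zero, hκ', hκ', ← map_add]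
    exact hmk _ (k4_anti1 X κ k2 k3 i j k l Q)
  have anti2 : ∀ i j k l Q, κ' i j k l Q = - κ' i j l k Q := fun i j k l Q => by
    rw [eq_neg_iff_add_eq_zero, hκ', hκ', ← map_add]
    exact hmk _ (k4_anti2 X κ i j k l Q)
  have jac1 : ∀ i j a k l Q, κ' i j k l (yv K a * Q) + κ' j a k l (yv K i * Q)
      + κ' a i k l (yv K j * Q) = 0 := fun i j a k l Q => by
    rw [hκ', hκ', hκ', ← map_add, ← map_add]
    exact hmk _ (k4_jac1 X κ k2 k3 i j a k l Q)
  have jac2 : ∀ i j k l a Q, κ' i j k l (yv K a * Q) + κ' i j l a (yv K k * Q)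
      + κ' i j a k (yv K l * Q) = 0 := fun i j k l a Q => by
    rw [hκ', hκ', hκ', ← map_add, ← map_add]
    exact hmk _ (k4_jac2 X H κ k1 k3 i j k l a Q)
  have hS : ∀ i j k l Q, kw κ' i j k l Q ∈ (SW (K := K) X).map (CI K R ^ 3).mkQ := by
    intro i j k l Q
    refine poly_ind (((SW (K := K) X).map (CI K R ^ 3).mkQ).comap (kw κ' i j k l)) ?_ ?_ Q
    · have h1 : ∀ i j k l, κ' i j k l 1 = (CI K R ^ 3).mkQ (br (X i) (X j) * br (X k) (X l)) := by
        intro i j k l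
        rw [hκ', ← sub_eq_zero, ← map_sub, k4_apply, ← sub_mul]
        exact hmk _ (m21 (k2 i j) (br_CI _ _))
      refine ⟨ww (X i) (X j) (X k) (X l), ?_, ?_⟩
      · rw [← one_mul (ww _ _ _ _)]
        exact Submodule.mul_mem_mul trivial (Submodule.subset_span ⟨i, j, k, l, rfl⟩)
      · simp only [kw, ww, LinearMap.add_apply, LinearMap.sub_apply, h1, map_add, map_sub]
    · rintro (a | a) Q hQ
      · obtain ⟨s, hs, e⟩ := hQ
        refine ⟨X a * s, ?_, ?_⟩
        · have : X a * s ∈ (⊤ : Submodule K R) * SW (K := K) X := Submodule.mul_mem_mul trivial hs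
          rw [SW, ← mul_assoc, tt] at this
          exact this
        · have hx : ∀ i j k l, κ' i j k l (MvPolynomial.X (Sum.inl a) * Q)
              = (CI K R ^ 3).mkQ (X a * k4 X κ i j k l Q) := by
            intro i j k l
            rw [hκ', ← sub_eq_zero, ← map_sub]
            exact hmk _ (k4_x X κ k3 i j k l a Q)
          have e2 : s - (k4 X κ i j k l Q + k4 X κ k l i j Q - k4 X κ k j i l Q + k4 X κ k i j l Q
             + k4 X κ l j i k Q - k4 X κ l i j k Q) ∈ CI K R ^ 3 := by
            rw [← Submodule.Quotient.mk_eq_zero, ← Submodule.mkQ_apply, map_sub, e, sub_eq_zero]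
            simp only [kw, LinearMap.add_apply, LinearMap.sub_apply, hκ', map_add, map_sub]
          have e3 := hmk _ (ml (X a) e2)
          rw [mul_sub, map_sub, sub_eq_zero] at e3
          rw [e3]
          simp only [kw, LinearMap.add_apply, LinearMap.sub_apply, hx, map_add, map_sub, mul_add,
            mul_sub]
      · show kw κ' i j k l (yv K a * Q) ∈ (SW (K := K) X).map (CI K R ^ 3).mkQ
        rw [kw_y κ' anti1 anti2 jac1 jac2]
        exact zero_mem _
  have := K2 κ' anti1 anti2 jac1 jac2 _ hS c
    (fun p => by
      have := hF p _ hc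
      rw [map_sub, h0, map_sum, zero_sub, neg_eq_zero] at this
      simp only [k4_apply, hk, Finset.sum_neg_distrib, neg_eq_zero] at this
      exact this)
  simp only [hκ', ← map_sum] at this
  obtain ⟨s, hs, e⟩ := this
  rw [← sub_eq_zero, ← map_sub, Submodule.mkQ_apply, Submodule.Quotient.mk_eq_zero] at e
  have : r = s + ((r - ∑ t, k4 X κ t.1 t.2.1 t.2.2.1 t.2.2.2 (c t))
     - (s - ∑ t, k4 X κ t.1 t.2.1 t.2.2.1 t.2.2.2 (c t))) := by abel
  rw [this]
  exact add_mem (Submodule.mem_sup_left hs) (Submodule.mem_sup_right (sub_mem hc e))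
end levels2

section tri
variable (K : Type*) [Field K] (P : Type*) [CommRing P] [Algebra K P]

/-- upper triangular matrices with equal corner entries -/
def UT : Subalgebra K (Matrix (Fin 3) (Fin 3) P) where
  carrier := {A | A 1 0 = 0 ∧ A 2 0 = 0 ∧ A 2 1 = 0 ∧ A 2 2 = A 0 0}
  add_mem' := by
    rintro A B ⟨h1, h2, h3, h4⟩ ⟨g1, g2, g3, g4⟩
    simp [h1, h2, h3, h4, g1, g2, g3, g4]
  mul_mem' := by
    rintro A B ⟨h1, h2, h3, h4⟩ ⟨g1, g2, g3, g4⟩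
    simp [Matrix.mul_apply, Fin.sum_univ_three, h1, h2, h3, h4, g1, g2, g3, g4]
  algebraMap_mem' := by
    intro r
    simp [Matrix.algebraMap_matrix_apply]

variable {K P}
/-- entries -/
def ent (i j : Fin 3) : UT K P →ₗ[K] P where
  toFun A := A.1 i j
  map_add' _ _ := rfl
  map_smul' _ _ := rfl

lemma ent_ap (i j : Fin 3) (A : UT K P) : ent i j A = (A : Matrix (Fin 3) (Fin 3) P) i j := rfl
lemma UT_mem (A : UT K P) : (A : Matrix (Fin 3) (Fin 3) P) 1 0 = 0 ∧
  (A : Matrix (Fin 3) (Fin 3) P) 2 0 = 0 ∧ (A : Matrix (Fin 3) (Fin 3) P) 2 1 = 0 ∧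
  (A : Matrix (Fin 3) (Fin 3) P) 2 2 = (A : Matrix (Fin 3) (Fin 3) P) 0 0 := A.2

lemma ent00 (A B : UT K P) : ent 0 0 (A * B) = ent 0 0 A * ent 0 0 B := by
  obtain ⟨h1, h2, h3, h4⟩ := UT_mem A; obtain ⟨g1, g2, g3, g4⟩ := UT_mem B
  simp [ent_ap, Matrix.mul_apply, Fin.sum_univ_three, h1, h2, h3, h4, g1, g2, g3, g4]
lemma ent11 (A B : UT K P) : ent 1 1 (A * B) = ent 1 1 A * ent 1 1 B := by
  obtain ⟨h1, h2, h3, h4⟩ := UT_mem A; obtain ⟨g1, g2, g3, g4⟩ := UT_mem B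
  simp [ent_ap, Matrix.mul_apply, Fin.sum_univ_three, h1, h2, h3, h4, g1, g2, g3, g4]
lemma ent01 (A B : UT K P) : ent 0 1 (A * B) = ent 0 0 A * ent 0 1 B + ent 0 1 A * ent 1 1 B := by
  obtain ⟨h1, h2, h3, h4⟩ := UT_mem A; obtain ⟨g1, g2, g3, g4⟩ := UT_mem B
  simp [ent_ap, Matrix.mul_apply, Fin.sum_univ_three, h1, h2, h3, h4, g1, g2, g3, g4]
lemma ent12 (A B : UT K P) : ent 1 2 (A * B) = ent 1 1 A * ent 1 2 B + ent 1 2 A * ent 0 0 B := by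
  obtain ⟨h1, h2, h3, h4⟩ := UT_mem A; obtain ⟨g1, g2, g3, g4⟩ := UT_mem B
  simp [ent_ap, Matrix.mul_apply, Fin.sum_univ_three, h1, h2, h3, h4, g1, g2, g3, g4]
lemma ent02 (A B : UT K P) : ent 0 2 (A * B) = ent 0 0 A * ent 0 2 B + ent 0 1 A * ent 1 2 B
    + ent 0 2 A * ent 0 0 B := by
  obtain ⟨h1, h2, h3, h4⟩ := UT_mem A; obtain ⟨g1, g2, g3, g4⟩ := UT_mem B
  simp [ent_ap, Matrix.mul_apply, Fin.sum_univ_three, h1, h2, h3, h4, g1, g2, g3, g4]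
lemma UT_ext (A B : UT K P) (h0 : ent 0 0 A = ent 0 0 B) (h1 : ent 1 1 A = ent 1 1 B)
    (h2 : ent 0 1 A = ent 0 1 B) (h3 : ent 1 2 A = ent 1 2 B) (h4 : ent 0 2 A = ent 0 2 B) :
    A = B := by
  obtain ⟨f1, f2, f3, f4⟩ := UT_mem A; obtain ⟨g1, g2, g3, g4⟩ := UT_mem B
  simp only [ent_ap] at h0 h1 h2 h3 h4
  apply Subtype.ext
  ext i j
  fin_cases i <;> fin_cases j <;> simp_all

lemma ent_br (A B : UT K P) : ent 0 0 (br A B) = 0 ∧ ent 1 1 (br A B) = 0 := by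
  simp [br, ent00, ent11, mul_comm]

lemma HH_UT : HH (UT K P) := by
  intro a b c d e
  obtain ⟨h1, h2⟩ := ent_br a b
  obtain ⟨h3, h4⟩ := ent_br c d
  apply UT_ext <;> simp [ent00, ent11, ent01, ent12, ent02, h1, h2, h3, h4]
  ring

variable {R : Type*} [Ring R] [Algebra K R]

lemma UT_CI (θ : R →ₐ[K] UT K P) : ∀ v ∈ CI K R, ent 0 0 (θ v) = 0 ∧ ent 1 1 (θ v) = 0 := by
  intro v hv
  have : CI K R ≤ LinearMap.ker (ent 0 0 ∘ₗ θ.toLinearMap) ⊓ LinearMap.ker (ent 1 1 ∘ₗ θ.toLinearMap) := by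
    rw [CI_eq, Submodule.mul_le]
    intro a _ b hb
    have : BB K R ≤ LinearMap.ker (ent 0 0 ∘ₗ θ.toLinearMap) ⊓ LinearMap.ker (ent 1 1 ∘ₗ θ.toLinearMap) := by
      rw [BB, Submodule.span_le]
      rintro _ ⟨a, b, rfl⟩
      have := ent_br (θ a) (θ b)
      simpa [br] using this
    have hb' := this hb
    simp only [Submodule.mem_inf, LinearMap.mem_ker, LinearMap.comp_apply, AlgHom.toLinearMap_apply,
      map_mul, ent00, ent11] at hb' ⊢
    simp [hb']
  exact this hv

lemma UT_CI2 (θ : R →ₐ[K] UT K P) : ∀ v ∈ CI K R ^ 2, ent 0 1 (θ v) = 0 ∧ ent 1 2 (θ v) = 0 := by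
  intro v hv
  have : CI K R ^ 2 ≤ LinearMap.ker (ent 0 1 ∘ₗ θ.toLinearMap) ⊓ LinearMap.ker (ent 1 2 ∘ₗ θ.toLinearMap) := by
    rw [pow_two, Submodule.mul_le]
    intro a ha b hb
    have h1 := UT_CI θ a ha
    have h2 := UT_CI θ b hb
    simp [ent01, ent12, h1, h2]
  exact this hv

lemma UT_CI3 (θ : R →ₐ[K] UT K P) : ∀ v ∈ CI K R ^ 3, ent 0 2 (θ v) = 0 := by
  intro v hv
  have : CI K R ^ 3 ≤ LinearMap.ker (ent 0 2 ∘ₗ θ.toLinearMap) := by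
    rw [pow_succ, Submodule.mul_le]
    intro a ha b hb
    have h1 := UT_CI2 θ a ha
    have h2 := UT_CI θ b hb
    have h3 := UT_CI θ a (by simpa using CIle (n := 0) ha)
    simp [ent02, h1, h2, h3]
  exact this hv
end tri

section lev12
variable {K : Type*} [Field K] [CharZero K] {R : Type*} [Ring R] [Algebra K R] {m : ℕ}

/-- the generic triangular matrices -/
def tm (K : Type*) [Field K] {m : ℕ} (i0 j0 a : Fin m) : UT K (PP K m) :=
  ⟨!![MvPolynomial.X (Sum.inl a), if a = i0 then 1 else 0, 0;
      0, MvPolynomial.X (Sum.inl a) + yv K a, if a = j0 then 1 else 0;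
      0, 0, MvPolynomial.X (Sum.inl a)], by simp [UT]⟩

lemma tm_val (i0 j0 a : Fin m) : ((tm K i0 j0 a : UT K (PP K m)) : Matrix (Fin 3) (Fin 3) (PP K m)) =
  !![MvPolynomial.X (Sum.inl a), if a = i0 then 1 else 0, 0;
      0, MvPolynomial.X (Sum.inl a) + yv K a, if a = j0 then 1 else 0;
      0, 0, MvPolynomial.X (Sum.inl a)] := rfl

lemma level012 (X : Fin m → R) (hX : Algebra.adjoin K (Set.range X) = ⊤) (H : HH R)
    (ab : R →ₐ[K] MvPolynomial (Fin m) K) (hab : ∀ a, ab (X a) = MvPolynomial.X a)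
    (θ : Fin m → Fin m → R →ₐ[K] UT K (PP K m)) (hθ : ∀ i j a, θ i j (X a) = tm K i j a)
    (r : R) (h0 : ab r = 0) (h1 : ∀ i j, ent 0 1 (θ i j r) = 0)
    (h2 : ∀ i j, ent 0 2 (θ i j r) = 0) : r ∈ SW (K := K) X ⊔ CI K R ^ 3 := by
  have hr0 := level0 X hX ab hab r h0
  obtain ⟨κ, k1, k2, k3⟩ := exk1 (K := K) X
  have e0 : ∀ i j a, ent 0 0 (θ i j (X a)) = MvPolynomial.X (Sum.inl a) := by
    intro i j a; rw [hθ]; simp [ent_ap, tm_val]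
  have e1 : ∀ i j a, ent 1 1 (θ i j (X a)) = MvPolynomial.X (Sum.inl a) + yv K a := by
    intro i j a; rw [hθ]; simp [ent_ap, tm_val]
  have e01 : ∀ i j a, ent 0 1 (θ i j (X a)) = if a = i then 1 else 0 := by
    intro i j a; rw [hθ]; simp [ent_ap, tm_val]
  have e12 : ∀ i j a, ent 1 2 (θ i j (X a)) = if a = j then 1 else 0 := by
    intro i j a; rw [hθ]; simp [ent_ap, tm_val]
  have b01 : ∀ p q i j, ent 0 1 (θ p q (br (X i) (X j))) = dl i j p := by
    intro p q i j
    simp only [br, map_sub, map_mul, ent01, e0, e1, e01, dl]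
    split_ifs <;> ring
  have b12 : ∀ p q i j, ent 1 2 (θ p q (br (X i) (X j))) = - dl i j q := by
    intro p q i j
    simp only [br, map_sub, map_mul, ent12, e0, e1, e12, dl]
    split_ifs <;> ring
  have hk : ∀ p q i j Q, ent 0 1 (θ p q (κ i j Q)) = Q * dl i j p := by
    intro p q i j Q
    refine poly_ind (LinearMap.ker (ent 0 1 ∘ₗ (θ p q).toLinearMap ∘ₗ κ i j
      - LinearMap.mulRight K (dl i j p))) ?_ ?_ Q |> fun h => by
      simpa [sub_eq_zero] using h
    · have := (UT_CI2 (θ p q) _ (k2 i j)).1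
      rw [map_sub, map_sub, b01, sub_eq_zero] at this
      simp [this]
    · intro s Q hQ
      have h3 := (UT_CI2 (θ p q) _ (k3 i j s Q)).1
      have h4 := UT_CI (θ p q) _ (k1 i j Q)
      rw [map_sub, map_sub, sub_eq_zero] at h3
      simp only [LinearMap.mem_ker, LinearMap.sub_apply, LinearMap.comp_apply,
        AlgHom.toLinearMap_apply, LinearMap.mulRight_apply, sub_eq_zero] at hQ ⊢
      rw [h3]
      rcases s with a | a
      · rw [TT_inl, map_mul, ent01, hQ, h4.2, e0]; ring
      · rw [TT_inr, br, map_sub, map_sub, map_mul (θ p q), map_mul (θ p q), ent01, ent01, hQ, h4.1, h4.2, e0, e1]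
        rw [yv]; ring
  have hr1 := level1' X hX κ k1 k2 k3 (fun p => ent 0 1 ∘ₗ (θ p p).toLinearMap)
    (fun p v hv => (UT_CI2 (θ p p) v hv).1) (fun p i j Q => hk p p i j Q) r hr0 (fun p => h1 p p)
  refine level2' X hX H κ k1 k2 k3 (fun p => ent 0 2 ∘ₗ (θ p.1 p.2).toLinearMap)
    (fun p v hv => (UT_CI3 (θ p.1 p.2) v hv)) (fun p i j k l Q => ?_) r hr1 (fun p => h2 p.1 p.2)
  have h4 := UT_CI (θ p.1 p.2) _ (k1 i j Q)
  have h5 := UT_CI (θ p.1 p.2) _ (br_CI (X k) (X l))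
  simp only [LinearMap.comp_apply, AlgHom.toLinearMap_apply, map_mul, ent02, h4, h5, hk, b12]
  ring
end lev12

section zlist
variable {R : Type*} [Ring R]

/-- product of consecutive commutators -/
def Zp : List R → R
  | a :: b :: l => br a b * Zp l
  | _ => 1

lemma Zp_cons (a b : R) (l : List R) : Zp (a :: b :: l) = br a b * Zp l := by rw [Zp]

lemma Zp_swap1 (H : HH R) (a b : R) : ∀ (p l : List R), (p.length + l.length) % 2 = 0 → ∀ q r : R,
    br q r * Zp (p ++ a :: b :: l) = - (br q r * Zp (p ++ b :: a :: l))
  | [], l, _, q, r => by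
    simp only [List.nil_append, Zp_cons]
    rw [br_swap a b]; noncomm_ring
  | [x], [], h, q, r => by simp at h
  | [x], e :: l, _, q, r => by
    simp only [List.cons_append, List.nil_append, Zp_cons]
    rw [← mul_assoc, ← mul_assoc, ← mul_assoc, ← mul_assoc, A1 H]; noncomm_ring
  | x :: y :: p, l, h, q, r => by
    have := Zp_swap1 H a b p l (by simp at h; omega) x y
    simp only [List.cons_append, Zp_cons]
    rw [this]; noncomm_ring

lemma Zp_swap (H : HH R) (a b : R) : ∀ (p l : List R), (p.length + l.length) % 2 = 0 →
    4 ≤ p.length + l.length → Zp (p ++ a :: b :: l) = - Zp (p ++ b :: a :: l)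
  | [], l, _, _ => by
    simp only [List.nil_append, Zp_cons]
    rw [br_swap a b]; noncomm_ring
  | [x], [], h, _ => by simp at h
  | [x], [_], _, h => by simp at h
  | [x], [_, _], _, h => by simp at h
  | [x], e :: u :: v :: l, _, _ => by
    simp only [List.cons_append, List.nil_append, Zp_cons]
    rw [← mul_assoc, ← mul_assoc, ← mul_assoc, ← mul_assoc, A2 H]; noncomm_ring
  | x :: y :: p, l, h, _ => by
    have := Zp_swap1 H a b p l (by simp at h; omega) x y
    simp only [List.cons_append, Zp_cons]
    rw [this]

/-- alternating words of degree four -/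
def Wp : List R → R
  | [a, b, c, d] => ww a b c d
  | _ => 0

lemma Wp_swap (a b : R) (p l : List R) (h : p.length + l.length = 2) :
    Wp (p ++ a :: b :: l) = - Wp (p ++ b :: a :: l) := by
  match p, l, h with
  | [], [c, d], _ => simp only [List.nil_append, Wp, ww, br]; noncomm_ring
  | [c], [d], _ => simp only [List.nil_append, List.cons_append, Wp, ww, br]; noncomm_ring
  | [c, d], [], _ => simp only [List.nil_append, List.cons_append, Wp, ww, br]; noncomm_ring
  | [], [], h => simp at h
  | [], [_], h => simp at h
  | [], _ :: _ :: _ :: l, h => simp at h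
  | [_], [], h => simp at h
  | [_], _ :: _ :: l, h => simp at h; omega
  | [_, _], _ :: l, h => simp at h
  | _ :: _ :: _ :: p, l, h => simp at h; omega

end zlist

section alt
variable {α V : Type*} [AddCommGroup V]

lemma alt_perm (n : ℕ) (f : List α → V) (hf : ∀ a b p l, p.length + l.length + 2 = n →
    f (p ++ a :: b :: l) = - f (p ++ b :: a :: l)) (l l' : List α) (h : l.Perm l') :
    ∀ p : List α, p.length + l.length = n → f (p ++ l) = f (p ++ l') ∨ f (p ++ l) = - f (p ++ l') := by
  induction h with
  | nil => intro p _; exact Or.inl rfl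
  | cons x _ ih =>
    intro p hp
    have := ih (p ++ [x]) (by simp at hp ⊢; omega)
    simpa using this
  | swap x y l =>
    intro p hp
    exact Or.inr (hf _ _ _ _ (by simp at hp; omega))
  | trans h1 h2 i1 i2 =>
    intro p hp
    have e1 := i1 p hp
    have e2 := i2 p (by rw [← h1.length_eq]; exact hp)
    rcases e1 with e1 | e1 <;> rcases e2 with e2 | e2 <;> rw [e1, e2] <;> simp

lemma alt_span (K : Type*) [Field K] [CharZero K] [Module K V] [DecidableEq α] (n : ℕ) (f : List α → V)
    (hf : ∀ a b p l, p.length + l.length + 2 = n →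
    f (p ++ a :: b :: l) = - f (p ++ b :: a :: l)) (l : List α) (hl : l.length = n) :
    f l ∈ Submodule.span K {x | ∃ J : Finset α, J.card = n ∧ x = f J.toList} := by
  by_cases hd : l.Nodup
  · have h := alt_perm n f hf _ _ (List.toFinset_toList hd).symm [] (by simpa using hl)
    have hm : f l.toFinset.toList ∈ Submodule.span K {x | ∃ J : Finset α, J.card = n ∧ x = f J.toList} :=
      Submodule.subset_span ⟨_, by rw [List.toFinset_card_of_nodup hd, hl], rfl⟩
    rcases h with h | h <;> simp only [List.nil_append] at h <;> rw [h]
    · exact hm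
    · exact neg_mem hm
  · obtain ⟨a, ha⟩ := List.exists_duplicate_iff_not_nodup.2 hd
    have : (List.replicate 2 a).Sublist l := List.duplicate_iff_sublist.1 ha
    obtain ⟨l', hl'⟩ := this.exists_perm_append
    have hp : l.Perm (a :: a :: l') := by simpa [List.replicate] using hl'
    have h := alt_perm n f hf _ _ hp [] (by simpa using hl)
    have h0 : f (a :: a :: l') = 0 := by
      have h1 := hf a a [] l' (by have := hp.length_eq; simp at this ⊢; omega)
      simp only [List.nil_append] at h1
      have h2 : (2:K) • f (a :: a :: l') = 0 := by
        rw [two_smul]; nth_rewrite 1 [h1]; simp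
      simpa using h2
    have : f l = 0 := by
      rcases h with h | h <;> simp only [List.nil_append] at h <;> rw [h, h0]
      simp
    rw [this]; exact zero_mem _
end alt

section gen
variable {K : Type*} [Field K] [CharZero K] {R : Type*} [Ring R] [Algebra K R] {m : ℕ}

lemma CIn_eq (k : ℕ) : CI K R ^ (k+1) = ⊤ * BB K R ^ (k+1) := by
  induction k with
  | zero => simpa using CI_eq
  | succ k ih =>
    rw [pow_succ', ih, ← mul_assoc, CItt, CI_eq, mul_assoc, ← pow_succ']

/-- span of commutators of generators -/
def GG (K : Type*) [Field K] {R : Type*} [Ring R] [Algebra K R] {m : ℕ} (X : Fin m → R) : Submodule K R :=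
  Submodule.span K {x | ∃ i j, x = br (X i) (X j)}

lemma GB (X : Fin m → R) : GG K X ≤ BB K R := by
  rw [GG, Submodule.span_le]; rintro _ ⟨i, j, rfl⟩; exact br_BB K _ _

lemma A3B (H : HH R) (a b c : R) : ∀ g ∈ BB K R * BB K R, br (br a b) c * g = 0 := by
  have : BB K R * BB K R ≤ LinearMap.ker (LinearMap.mulLeft K (br (br a b) c)) := by
    rw [BB, Submodule.span_mul_span, Submodule.span_le]
    rintro _ ⟨_, ⟨d, e, rfl⟩, _, ⟨f, g, rfl⟩, rfl⟩
    have := A3 K H a b c d e f g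
    simpa [mul_assoc] using this
  intro g hg; exact this hg

lemma BBcen (H : HH R) (e : R) : ∀ g ∈ BB K R * BB K R, g * e = e * g := by
  have : BB K R * BB K R ≤ LinearMap.ker (LinearMap.mulLeft K e - LinearMap.mulRight K e) := by
    rw [BB, Submodule.span_mul_span, Submodule.span_le]
    rintro _ ⟨_, ⟨d, e, rfl⟩, _, ⟨f, g, rfl⟩, rfl⟩
    simp [H d e f g, sub_eq_zero]
  intro g hg
  have := this hg
  simp [sub_eq_zero] at this
  exact this.symm

lemma BBG (X : Fin m → R) (hX : Algebra.adjoin K (Set.range X) = ⊤) (G : Submodule K R)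
    (h3 : ∀ a b c, ∀ g ∈ G, br (br a b : R) c * g = 0) : BB K R * G ≤ ⊤ * (GG K X * G) := by
  rw [BB, Submodule.mul_le]
  intro x hx g hg
  have hl : ∀ r : R, ∀ s ∈ (⊤ : Submodule K R) * (GG K X * G), r * s ∈ (⊤ : Submodule K R) * (GG K X * G) := by
    intro r s hs
    rw [← tt, mul_assoc]; exact Submodule.mul_mem_mul trivial hs
  induction hx using Submodule.span_induction with
  | mem x hx =>
    obtain ⟨a, b, rfl⟩ := hx
    refine gen_br X hX (fun a b => br a b * g ∈ (⊤ : Submodule K R) * (GG K X * G)) ?_ ?_ ?_ ?_ ?_ a b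
    · intro a b h; rw [br_swap, neg_mul]; exact neg_mem h
    · intro t b
      have : br (algebraMap K R t) b = 0 := by rw [br, Algebra.commutes, sub_self]
      rw [this, zero_mul]; exact zero_mem _
    · intro a a' b h h'
      have : br (a + a') b = br a b + br a' b := by unfold br; noncomm_ring
      rw [this, add_mul]; exact add_mem h h'
    · intro a a' b h h'
      have : br (a * a') b * g = a * (br a' b * g) + a' * (br a b * g) + br (br a b) a' * g := by
        unfold br; noncomm_ring
      rw [this, h3 _ _ _ g hg, add_zero]
      exact add_mem (hl _ _ h') (hl _ _ h)
    · intro i j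
      rw [← one_mul (br (X i) (X j) * g)]
      exact Submodule.mul_mem_mul trivial (Submodule.mul_mem_mul (Submodule.subset_span ⟨i, j, rfl⟩) hg)
  | zero => rw [zero_mul]; exact zero_mem _
  | add x y _ _ h1 h2 => rw [add_mul]; exact add_mem h1 h2
  | smul t x _ h => rw [smul_mul_assoc]; exact Submodule.smul_mem _ _ h

lemma cen_comm (H : HH R) (A : Submodule K R) (C : Submodule K R) (hC : C ≤ BB K R * BB K R) :
    A * C = C * A := by
  apply le_antisymm <;> rw [Submodule.mul_le]
  · intro a ha c hc
    rw [← BBcen H a c (hC hc)]; exact Submodule.mul_mem_mul hc ha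
  · intro c hc a ha
    rw [BBcen H a c (hC hc)]; exact Submodule.mul_mem_mul ha hc

lemma BB3 (X : Fin m → R) (hX : Algebra.adjoin K (Set.range X) = ⊤) (H : HH R) :
    BB K R ^ 3 ≤ ⊤ * GG K X ^ 3 := by
  have hGB := GB (K := K) X
  have s1 : BB K R * (BB K R * BB K R) ≤ ⊤ * (GG K X * (BB K R * BB K R)) :=
    BBG X hX _ (fun a b c => A3B H a b c)
  have s2 : GG K X * (BB K R * BB K R) = BB K R * (BB K R * GG K X) := by
    rw [cen_comm H _ _ le_rfl, mul_assoc]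
  have s3 : BB K R * (BB K R * GG K X) ≤ ⊤ * (GG K X * (BB K R * GG K X)) :=
    BBG X hX _ (fun a b c g hg => A3B H a b c g (mul_le_mul' le_rfl hGB hg))
  have s4 : GG K X * (BB K R * GG K X) = BB K R * (GG K X * GG K X) := by
    rw [cen_comm H _ _ (mul_le_mul' le_rfl hGB), mul_assoc]
  have s5 : BB K R * (GG K X * GG K X) ≤ ⊤ * (GG K X * (GG K X * GG K X)) :=
    BBG X hX _ (fun a b c g hg => A3B H a b c g (mul_le_mul' hGB hGB hg))
  have e : ∀ A : Submodule K R, A ^ 3 = A * (A * A) := fun A => by rw [pow_succ', pow_two]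
  have tl : ∀ A B : Submodule K R, A ≤ ⊤ * B → ⊤ * A ≤ ⊤ * B := fun A B h => by
    calc ⊤ * A ≤ ⊤ * (⊤ * B) := mul_le_mul' le_rfl h
      _ = ⊤ * B := by rw [← mul_assoc, tt]
  rw [e, e]
  refine s1.trans (tl _ _ ?_)
  rw [s2]
  refine s3.trans (tl _ _ ?_)
  rw [s4]
  exact s5

lemma BBn (X : Fin m → R) (hX : Algebra.adjoin K (Set.range X) = ⊤) (H : HH R) (k : ℕ) :
    BB K R ^ (k+3) ≤ ⊤ * GG K X ^ (k+3) := by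
  induction k with
  | zero => exact BB3 X hX H
  | succ k ih =>
    have hGB := GB (K := K) X
    rw [show k + 1 + 3 = (k+3)+1 from rfl, pow_succ' (BB K R)]
    refine (mul_le_mul' le_rfl ih).trans ?_
    have h1 : BB K R * ⊤ ≤ ⊤ * BB K R := by
      rw [← CI_eq, CI]
      refine mul_le_mul' (fun x hx => ?_) le_rfl
      rw [← one_mul x]; exact Submodule.mul_mem_mul trivial hx
    rw [← mul_assoc]
    refine (mul_le_mul' h1 le_rfl).trans ?_
    rw [mul_assoc]
    refine (mul_le_mul' le_rfl (BBG X hX _ (fun a b c g hg => ?_))).trans ?_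
    · have : (GG K X) ^ (k+3) = (GG K X * GG K X) * GG K X ^ (k+1) := by
        rw [← pow_two, ← pow_add]; congr 1; omega
      rw [this] at hg
      refine Submodule.mul_induction_on hg ?_ ?_
      · intro u hu v _
        rw [← mul_assoc, A3B H a b c u (mul_le_mul' hGB hGB hu), zero_mul]
      · intro u v hu hv; rw [mul_add, hu, hv, add_zero]
    · rw [← mul_assoc, tt, ← pow_succ']

lemma GGn (X : Fin m → R) (k : ℕ) :
    GG K X ^ k ≤ Submodule.span K {x | ∃ l : List (Fin m), l.length = 2 * k ∧ x = Zp (l.map X)} := by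
  induction k with
  | zero =>
    rw [pow_zero, Submodule.one_eq_span, Submodule.span_le]
    rintro _ rfl
    exact Submodule.subset_span ⟨[], rfl, by simp [Zp]⟩
  | succ k ih =>
    rw [pow_succ']
    refine (mul_le_mul' le_rfl ih).trans ?_
    rw [GG, Submodule.span_mul_span]
    apply Submodule.span_mono
    rintro _ ⟨_, ⟨i, j, rfl⟩, _, ⟨l, hl, rfl⟩, rfl⟩
    exact ⟨i :: j :: l, by simp [hl]; ring, by simp [Zp_cons]⟩

/-- left ideal generated by a family of words -/
def LZ (K : Type*) [Field K] {R : Type*} [Ring R] [Algebra K R] {m : ℕ} (k : ℕ) (ζ : List (Fin m) → R) :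
    Submodule K R := ⊤ * Submodule.span K {x | ∃ J : Finset (Fin m), J.card = 2 * k ∧ x = ζ J.toList}

lemma CI_LZ (X : Fin m → R) (hX : Algebra.adjoin K (Set.range X) = ⊤) (H : HH R) (k : ℕ) :
    CI K R ^ (k+3) ≤ LZ K (k+3) (fun l => Zp (l.map X)) := by
  have h1 : CI K R ^ (k+3) ≤ ⊤ * GG K X ^ (k+3) := by
    rw [show k + 3 = (k+2)+1 from rfl, CIn_eq]
    refine (mul_le_mul' le_rfl (BBn X hX H k)).trans ?_
    rw [← mul_assoc, tt]
  refine h1.trans (mul_le_mul' le_rfl ((GGn X _).trans ?_))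
  rw [Submodule.span_le]
  rintro _ ⟨l, hl, rfl⟩
  refine alt_span K (2*(k+3)) (fun l => Zp (l.map X)) ?_ l hl
  intro a b p l hpl
  simp only [List.map_append, List.map_cons]
  exact Zp_swap H _ _ _ _ (by simp; omega) (by simp; omega)

lemma SW_LZ (X : Fin m → R) : SW (K := K) X ≤ LZ K 2 (fun l => Wp (l.map X)) := by
  refine mul_le_mul' le_rfl ?_
  rw [Submodule.span_le]
  rintro _ ⟨i, j, k, l, rfl⟩
  refine alt_span K 4 (fun l => Wp (l.map X)) ?_ [i, j, k, l] rfl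
  intro a b p l hpl
  simp only [List.map_append, List.map_cons]
  exact Wp_swap _ _ _ _ (by simp; omega)
end gen

section ext
variable {K : Type*} [Field K] [CharZero K]

/-- generators of the Grassmann algebra -/
def ee (K : Type*) [Field K] (a : ℕ) : GrassmannAlg K := ExteriorAlgebra.ι K (Finsupp.single a 1)

lemma ee_sq (a : ℕ) : ee K a * ee K a = 0 := ExteriorAlgebra.ι_sq_zero _
lemma ee_swap (a b : ℕ) : ee K a * ee K b = - (ee K b * ee K a) := by
  rw [eq_neg_iff_add_eq_zero]; exact ExteriorAlgebra.ι_add_mul_swap _ _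

lemma ee_prod (a : ℕ) (l : List ℕ) (h : a ∈ l) : ee K a * (l.map (ee K)).prod = 0 := by
  induction l with
  | nil => simp at h
  | cons b l ih =>
    rw [List.map_cons, List.prod_cons, ← mul_assoc]
    rcases List.mem_cons.1 h with rfl | h
    · rw [ee_sq, zero_mul]
    · rw [ee_swap, neg_mul, mul_assoc, ih h, mul_zero, neg_zero]

lemma ee_contr (a : ℕ) (l : List ℕ) (h : a ∉ l) :
    contractLeft (Q := (0 : QuadraticForm K (ℕ →₀ K))) (Finsupp.lapply a : (ℕ →₀ K) →ₗ[K] K)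
      (l.map (ee K)).prod = 0 := by
  induction l with
  | nil => rw [List.map_nil, List.prod_nil]; exact contractLeft_one _ _
  | cons b l ih =>
    rw [List.mem_cons, not_or] at h
    rw [List.map_cons, List.prod_cons]
    refine (contractLeft_ι_mul _ _ _).trans ?_
    rw [ih h.2, mul_zero, sub_zero, Finsupp.lapply_apply, Finsupp.single_apply, if_neg (Ne.symm h.1), zero_smul]

lemma ee_ne (l : List ℕ) (h : l.Nodup) : (l.map (ee K)).prod ≠ 0 := by
  induction l with
  | nil => simp
  | cons b l ih =>
    rw [List.nodup_cons] at h
    intro h0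
    rw [List.map_cons, List.prod_cons] at h0
    have h1 := congrArg (contractLeft (Q := (0 : QuadraticForm K (ℕ →₀ K)))
      (Finsupp.lapply b : (ℕ →₀ K) →ₗ[K] K)) h0
    rw [map_zero] at h1
    have h2 := (contractLeft_ι_mul (Q := (0 : QuadraticForm K (ℕ →₀ K)))
      (Finsupp.lapply b : (ℕ →₀ K) →ₗ[K] K) (Finsupp.single b 1) (l.map (ee K)).prod).symm.trans h1
    rw [ee_contr b l h.1, mul_zero, sub_zero, Finsupp.lapply_apply, Finsupp.single_eq_same, one_smul] at h2
    exact ih h.2 h2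

lemma E_iota (v : ℕ →₀ K) (x : GrassmannAlg K) :
    ExteriorAlgebra.ι K v * x = (involute (Q := (0 : QuadraticForm K (ℕ →₀ K))) x) * ExteriorAlgebra.ι K v := by
  induction x using ExteriorAlgebra.induction with
  | algebraMap r => rw [AlgHom.commutes, Algebra.commutes]
  | ι w =>
    have : (involute (Q := (0 : QuadraticForm K (ℕ →₀ K)))) (ExteriorAlgebra.ι K w) = - ExteriorAlgebra.ι K w :=
      involute_ι _
    rw [this, neg_mul, eq_neg_iff_add_eq_zero]; exact ExteriorAlgebra.ι_add_mul_swap _ _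
  | mul a b ha hb => rw [map_mul, ← mul_assoc, ha, mul_assoc, hb, mul_assoc]
  | add a b ha hb => rw [map_add, mul_add, ha, hb, add_mul]

lemma E_cen (x : GrassmannAlg K) (hx : involute (Q := (0 : QuadraticForm K (ℕ →₀ K))) x = x)
    (y : GrassmannAlg K) : y * x = x * y := by
  induction y using ExteriorAlgebra.induction with
  | algebraMap r => rw [Algebra.commutes]
  | ι w => rw [E_iota, hx]
  | mul a b ha hb => rw [mul_assoc, hb, ← mul_assoc, ha, mul_assoc]
  | add a b ha hb => rw [mul_add, add_mul, ha, hb]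

lemma E_br (a b : GrassmannAlg K) : involute (Q := (0 : QuadraticForm K (ℕ →₀ K))) (br a b) = br a b := by
  set σ := involute (Q := (0 : QuadraticForm K (ℕ →₀ K))) with hσ
  have hs : ∀ x : GrassmannAlg K, σ (σ x) = x := fun x => involute_involute x
  have h0 : ∀ x y : GrassmannAlg K, y * (x + σ x) = (x + σ x) * y := fun x y =>
    E_cen _ (by rw [map_add]; change σ x + σ (σ x) = _; rw [hs]; abel) y
  have e1 := h0 a b
  have e2 := h0 b (σ a)
  change σ (a * b - b * a) = a * b - b * a
  rw [map_sub, map_mul, map_mul]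
  rw [mul_add, add_mul] at e1 e2
  have h3 : σ a * σ b = b * σ a + σ b * σ a - σ a * b := by rw [← e2]; abel
  have h4 : b * a = a * b + σ a * b - b * σ a := by rw [← e1]; abel
  rw [h3, h4]; abel

lemma HH_E : HH (GrassmannAlg K) := by
  intro a b c d e
  exact (E_cen _ (by rw [map_mul, E_br, E_br]) e).symm
end ext

section el
variable {K : Type*} [Field K] [CharZero K] {m : ℕ}

/-- images of the generators -/
def el (J : Finset (Fin m)) (p : Fin m → K) (a : Fin m) : GrassmannAlg K :=
  algebraMap K _ (p a) + if a ∈ J then ee K a else 0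

lemma br_al (t u : K) (x y : GrassmannAlg K) :
    br (algebraMap K _ t + x) (algebraMap K _ u + y) = br x y := by
  unfold br
  have h1 := Algebra.commutes t u
  have h2 := Algebra.commutes (R := K) t y
  have h3 := Algebra.commutes (R := K) u x
  have h4 := Algebra.commutes (R := K) t (algebraMap K (GrassmannAlg K) u)
  simp only [mul_add, add_mul, h2, h3, h4]; abel

lemma br_el (J : Finset (Fin m)) (p : Fin m → K) (a b : Fin m) (ha : a ∈ J) (hb : b ∈ J) :
    br (el J p a) (el J p b) = (2:K) • (ee K a * ee K b) := by
  rw [el, el, br_al, if_pos ha, if_pos hb, br, ee_swap (b:ℕ) a, two_smul]; abel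
lemma br_el1 (J : Finset (Fin m)) (p : Fin m → K) (a b : Fin m) (ha : a ∉ J) :
    br (el J p a) (el J p b) = 0 := by
  rw [el, el, br_al, if_neg ha, br]; simp
lemma br_el2 (J : Finset (Fin m)) (p : Fin m → K) (a b : Fin m) (ha : a ∉ J) :
    br (el J p b) (el J p a) = 0 := by
  rw [el, el, br_al, if_neg ha, br]; simp

/-- Grassmann monomial -/
def emon (K : Type*) [Field K] (l : List (Fin m)) : GrassmannAlg K := ((l.map (fun a : Fin m => (a : ℕ))).map (ee K)).prod

lemma emon_ne (l : List (Fin m)) (h : l.Nodup) : emon K l ≠ 0 :=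
  ee_ne _ (h.map (fun _ _ h => Fin.ext h))
lemma emon_mul (a : Fin m) (l : List (Fin m)) (h : a ∈ l) : ee K a * emon K l = 0 :=
  ee_prod _ _ (List.mem_map.2 ⟨a, h, rfl⟩)
lemma emon_cons (a : Fin m) (l : List (Fin m)) : emon K (a :: l) = ee K a * emon K l := by simp [emon]

lemma Zp_el (J : Finset (Fin m)) (p : Fin m → K) : ∀ (k : ℕ) (l : List (Fin m)), l.length = 2 * k →
    (∀ a ∈ l, a ∈ J) → Zp (l.map (el J p)) = (2:K) ^ k • emon K l
  | 0, [], _, _ => by simp [Zp, emon]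
  | 0, _ :: _, h, _ => by simp at h
  | k+1, [], h, _ => by simp at h
  | k+1, [_], h, _ => by simp at h; omega
  | k+1, a :: b :: l, h, hl => by
    rw [List.map_cons, List.map_cons, Zp_cons, Zp_el J p k l (by simp at h; omega) (fun a ha => hl a (by simp [ha])),
      br_el J p a b (hl a (by simp)) (hl b (by simp)), emon_cons, emon_cons, smul_mul_smul_comm, pow_succ', mul_assoc]

lemma Zp_el0 (J : Finset (Fin m)) (p : Fin m → K) : ∀ (k : ℕ) (l : List (Fin m)), l.length = 2 * k →
    (∃ a ∈ l, a ∉ J) → Zp (l.map (el J p)) = 0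
  | _, [], _, h => by simp at h
  | 0, _ :: _, h, _ => by simp at h
  | k+1, [_], h, _ => by simp at h; omega
  | k+1, a :: b :: l, h, hl => by
    rw [List.map_cons, List.map_cons, Zp_cons]
    obtain ⟨c, hc, hJ⟩ := hl
    rcases List.mem_cons.1 hc with rfl | hc
    · rw [br_el1 _ _ _ _ hJ, zero_mul]
    rcases List.mem_cons.1 hc with rfl | hc
    · rw [br_el2 _ _ _ _ hJ, zero_mul]
    · rw [Zp_el0 J p k l (by simp at h; omega) ⟨c, hc, hJ⟩, mul_zero]

lemma Wp_el (J : Finset (Fin m)) (p : Fin m → K) (l : List (Fin m)) (h : l.length = 4)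
    (hl : ∀ a ∈ l, a ∈ J) : Wp (l.map (el J p)) = (24:K) • emon K l := by
  match l, h with
  | [a, b, c, d], _ =>
    have ha := hl a (by simp)
    have hb := hl b (by simp)
    have hc := hl c (by simp)
    have hd := hl d (by simp)
    simp only [List.map_cons, List.map_nil, Wp, ww]
    rw [br_el J p a b ha hb, br_el J p c d hc hd, br_el J p c b hc hb, br_el J p a d ha hd,
      br_el J p c a hc ha, br_el J p b d hb hd, br_el J p d b hd hb, br_el J p a c ha hc,
      br_el J p d a hd ha, br_el J p b c hb hc]
    simp only [emon_cons, smul_mul_smul_comm, ← smul_sub, ← smul_add]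
    have s1 := ee_swap (K := K) (b:ℕ) a
    have s2 := ee_swap (K := K) (c:ℕ) a
    have s3 := ee_swap (K := K) (d:ℕ) a
    have s4 := ee_swap (K := K) (c:ℕ) b
    have s5 := ee_swap (K := K) (d:ℕ) b
    have s6 := ee_swap (K := K) (d:ℕ) c
    have e0 : emon K ([] : List (Fin m)) = 1 := by simp [emon]
    rw [e0, mul_one]
    generalize ee K (a:ℕ) = A at *
    generalize ee K (b:ℕ) = B at *
    generalize ee K (c:ℕ) = C at *
    generalize ee K (d:ℕ) = D at *
    have t1 : ∀ z, B * (A * z) = -(A * (B * z)) := fun z => by rw [← mul_assoc, s1, neg_mul, mul_assoc]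
    have t2 : ∀ z, C * (A * z) = -(A * (C * z)) := fun z => by rw [← mul_assoc, s2, neg_mul, mul_assoc]
    have t3 : ∀ z, D * (A * z) = -(A * (D * z)) := fun z => by rw [← mul_assoc, s3, neg_mul, mul_assoc]
    have t4 : ∀ z, C * (B * z) = -(B * (C * z)) := fun z => by rw [← mul_assoc, s4, neg_mul, mul_assoc]
    have t5 : ∀ z, D * (B * z) = -(B * (D * z)) := fun z => by rw [← mul_assoc, s5, neg_mul, mul_assoc]
    have t6 : ∀ z, D * (C * z) = -(C * (D * z)) := fun z => by rw [← mul_assoc, s6, neg_mul, mul_assoc]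
    simp only [mul_assoc, s1, s2, s3, s4, s5, s6, t1, t2, t3, t4, t5, t6, mul_neg, neg_neg, neg_mul]
    module

lemma Wp_el0 (J : Finset (Fin m)) (p : Fin m → K) (l : List (Fin m)) (h : l.length = 4)
    (hl : ∃ a ∈ l, a ∉ J) : Wp (l.map (el J p)) = 0 := by
  match l, h with
  | [a, b, c, d], _ =>
    obtain ⟨x, hx, hJ⟩ := hl
    simp only [List.map_cons, List.map_nil, Wp, ww]
    simp only [List.mem_cons, List.not_mem_nil, or_false] at hx
    rcases hx with rfl | rfl | rfl | rfl <;> simp [br_el1 J p _ _ hJ, br_el2 J p _ _ hJ]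
end el

section step
variable {K : Type*} [Field K] [CharZero K] {R : Type*} [Ring R] [Algebra K R] {m : ℕ}

lemma step (X : Fin m → R) (hX : Algebra.adjoin K (Set.range X) = ⊤)
    (θ : Finset (Fin m) → (Fin m → K) → R →ₐ[K] GrassmannAlg K)
    (hθ : ∀ J p a, θ J p (X a) = el J p a) (n : ℕ) (ζ : List (Fin m) → R)
    (hζ : ∀ J : Finset (Fin m), J.card = 2 * (n+1) → ζ J.toList ∈ CI K R ^ (n+1))
    (hv : ∀ J p, J.card = 2 * (n+1) → ∀ v ∈ CI K R ^ (n+2), θ J p v = 0)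
    (hne : ∀ J p, J.card = 2 * (n+1) → ∃ c : K, c ≠ 0 ∧ θ J p (ζ J.toList) = c • emon K J.toList)
    (h0 : ∀ J p J', J.card = 2 * (n+1) → J'.card = 2 * (n+1) → J' ≠ J → θ J p (ζ J'.toList) = 0)
    (r : R) (hr : r ∈ LZ K (n+1) ζ ⊔ CI K R ^ (n+2)) (hr0 : ∀ J p, θ J p r = 0) :
    r ∈ CI K R ^ (n+2) := by
  classical
  have hex : ∀ J : {J : Finset (Fin m) // J.card = 2 * (n+1)}, _ := fun J =>
    exists_polyAct (fun a : Fin m => LinearMap.mulLeft K (X a)) (CI K R ^ (n+1)) (CI K R ^ (n+2))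
      (fun a v hv => ml _ hv) (fun a v hv => ml _ hv)
      (fun a b v hv => by
        have : X a * (X b * v) - X b * (X a * v) = br (X a) (X b) * v := by unfold br; noncomm_ring
        simp only [LinearMap.mulLeft_apply]
        rw [this, pow_succ']
        exact Submodule.mul_mem_mul (br_CI _ _) hv) (ζ J.1.toList) (hζ J.1 J.2)
  choose κ k1 k2 k3 using hex
  have hS : LZ K (n+1) ζ ⊔ CI K R ^ (n+2) ≤ (⨆ J, LinearMap.range (κ J)) ⊔ CI K R ^ (n+2) := by
    refine sup_le ?_ le_sup_right
    have hcl : ∀ a, ∀ s ∈ (⨆ J, LinearMap.range (κ J)) ⊔ CI K R ^ (n+2),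
        X a * s ∈ (⨆ J, LinearMap.range (κ J)) ⊔ CI K R ^ (n+2) := by
      intro a
      have : (⨆ J, LinearMap.range (κ J)) ⊔ CI K R ^ (n+2) ≤
        ((⨆ J, LinearMap.range (κ J)) ⊔ CI K R ^ (n+2)).comap (LinearMap.mulLeft K (X a)) := by
        refine sup_le (iSup_le fun J => ?_) ?_
        · rintro _ ⟨Q, rfl⟩
          have h1 := k3 J a Q
          have h2 : κ J (MvPolynomial.X a * Q) ∈ (⨆ J, LinearMap.range (κ J)) ⊔ CI K R ^ (n+2) :=
            Submodule.mem_sup_left (Submodule.mem_iSup_of_mem J ⟨_, rfl⟩)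
          have := sub_mem h2 (Submodule.mem_sup_right h1)
          simpa using this
        · intro v hv
          exact Submodule.mem_sup_right (ml _ hv)
      intro s hs; exact this hs
    rw [LZ, Submodule.mul_le]
    intro a _ b hb
    refine gen_left X hX _ hcl a b ?_
    refine (Submodule.span_le.2 ?_) hb
    rintro _ ⟨J, hJ, rfl⟩
    have h2 : κ ⟨J, hJ⟩ 1 ∈ (⨆ J, LinearMap.range (κ J)) ⊔ CI K R ^ (n+2) :=
      Submodule.mem_sup_left (Submodule.mem_iSup_of_mem ⟨J, hJ⟩ ⟨_, rfl⟩)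
    have := sub_mem h2 (Submodule.mem_sup_right (k2 ⟨J, hJ⟩))
    simpa using this
  obtain ⟨c, hc⟩ := exists_sum κ _ r (hS hr)
  have hact : ∀ (J J' : {J : Finset (Fin m) // J.card = 2 * (n+1)}) p a,
      el J.1 p a * θ J.1 p (ζ J'.1.toList) = p a • θ J.1 p (ζ J'.1.toList) := by
    intro J J' p a
    by_cases hJ : J' = J
    · subst hJ
      obtain ⟨c, _, h⟩ := hne J'.1 p J'.2
      rw [h, el, add_mul, ← Algebra.smul_def]
      split_ifs with ha
      · rw [mul_smul_comm, emon_mul a _ (by simpa using ha), smul_zero, add_zero]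
      · simp
    · rw [h0 J.1 p J'.1 J.2 J'.2 (fun h => hJ (Subtype.ext h))]; simp
  have hev : ∀ (J J' : {J : Finset (Fin m) // J.card = 2 * (n+1)}) p Q,
      θ J.1 p (κ J' Q) = MvPolynomial.eval p Q • θ J.1 p (ζ J'.1.toList) := by
    intro J J' p Q
    induction Q using MvPolynomial.induction_on with
    | C a =>
      have h1 := hv J.1 p J.2 _ (k2 J')
      rw [map_sub, sub_eq_zero] at h1
      rw [MvPolynomial.eval_C, ← h1, ← map_smul, ← map_smul, MvPolynomial.smul_eq_C_mul, mul_one]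
    | add P Q hP hQ => simp only [map_add, hP, hQ, add_smul]
    | mul_X Q a hQ =>
      have h1 := hv J.1 p J.2 _ (k3 J' a Q)
      rw [map_sub, sub_eq_zero] at h1
      rw [mul_comm Q, h1, LinearMap.mulLeft_apply, map_mul, hθ, hQ, mul_smul_comm, hact, map_mul,
        MvPolynomial.eval_X, smul_smul, mul_comm (p a)]
  have hc0 : ∀ J, c J = 0 := by
    intro J
    apply MvPolynomial.funext
    intro p
    have h1 := hv J.1 p J.2 _ hc
    rw [map_sub, hr0, zero_sub, neg_eq_zero, map_sum, Finset.sum_eq_single J] at h1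
    · obtain ⟨c0, hc0, h⟩ := hne J.1 p J.2
      rw [hev, h, smul_eq_zero, smul_eq_zero] at h1
      have := emon_ne (K := K) J.1.toList J.1.nodup_toList
      simpa [hc0, this] using h1
    · intro J' _ hJ'
      rw [hev, h0 J.1 p J'.1 J.2 J'.2 (fun h => hJ' (Subtype.ext h)), smul_zero]
    · simp
  simpa [hc0] using hc

lemma map_br {S : Type*} [Ring S] [Algebra K S] (θ : R →ₐ[K] S) (a b : R) : θ (br a b) = br (θ a) (θ b) := by
  simp [br]

lemma map_Zp {S : Type*} [Ring S] [Algebra K S] (θ : R →ₐ[K] S) : ∀ l : List R, θ (Zp l) = Zp (l.map θ)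
  | [] => by simp [Zp]
  | [_] => by simp [Zp]
  | a :: b :: l => by simp [Zp_cons, map_br, map_Zp θ l]

lemma map_Wp {S : Type*} [Ring S] [Algebra K S] (θ : R →ₐ[K] S) (l : List R) (h : l.length = 4) :
    θ (Wp l) = Wp (l.map θ) := by
  match l, h with
  | [a, b, c, d], _ => simp [Wp, ww, map_br]

lemma Zp_CI : ∀ (k : ℕ) (l : List R), l.length = 2 * (k+1) → Zp l ∈ CI K R ^ (k+1)
  | _, [], h => by simp at h
  | _, [_], h => by simp at h; omega
  | 0, a :: b :: c :: l, h => by simp at h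
  | 0, [a, b], h => by simpa [Zp] using br_CI a b
  | k+1, a :: b :: l, h => by
    rw [Zp_cons, pow_succ']
    exact Submodule.mul_mem_mul (br_CI _ _) (Zp_CI k l (by simp at h; omega))

lemma Wp_CI (l : List R) : Wp l ∈ CI K R ^ 2 := by
  unfold Wp
  split
  · unfold ww
    have h : ∀ a b c d : R, br a b * br c d ∈ CI K R ^ 2 := fun a b c d => m11 (br_CI _ _) (br_CI _ _)
    exact sub_mem (add_mem (add_mem (sub_mem (add_mem (h _ _ _ _) (h _ _ _ _)) (h _ _ _ _)) (h _ _ _ _)) (h _ _ _ _)) (h _ _ _ _)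
  · exact zero_mem _

lemma exists_not_mem (J J' : Finset (Fin m)) (h : J.card ≤ J'.card) (hne : J' ≠ J) :
    ∃ a ∈ J'.toList, a ∉ J := by
  by_contra hc
  push Not at hc
  exact hne (Finset.eq_of_subset_of_card_le (fun a ha => hc a (by simpa using ha)) h)

lemma level_top (X : Fin m → R) (hX : Algebra.adjoin K (Set.range X) = ⊤) (H : HH R)
    (θ : Finset (Fin m) → (Fin m → K) → R →ₐ[K] GrassmannAlg K)
    (hθ : ∀ J p a, θ J p (X a) = el J p a) 
    (r : R) (hr : r ∈ SW (K := K) X ⊔ CI K R ^ 3) (hr0 : ∀ J p, θ J p r = 0) : r = 0 := by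
  have hmap : ∀ J p (l : List (Fin m)), (l.map X).map (θ J p) = l.map (el J p) := by
    intro J p l; rw [List.map_map]; congr 1; funext a; exact hθ J p a
  have hv : ∀ (n : ℕ) J p, J.card = 2 * (n+2) → ∀ v ∈ CI K R ^ (n+3), θ J p v = 0 := by
    intro n J p hJ v hv
    have : LZ K (n+3) (fun l => Zp (l.map X)) ≤ LinearMap.ker (θ J p).toLinearMap := by
      rw [LZ, Submodule.mul_le]
      intro a _ b hb
      have : Submodule.span K {x | ∃ J : Finset (Fin m), J.card = 2 * (n+3) ∧ x = Zp (J.toList.map X)}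
        ≤ LinearMap.ker (θ J p).toLinearMap := by
        rw [Submodule.span_le]
        rintro _ ⟨J', hJ', rfl⟩
        simp only [SetLike.mem_coe, LinearMap.mem_ker, AlgHom.toLinearMap_apply]
        rw [map_Zp, hmap]
        exact Zp_el0 J p (n+3) _ (by simpa using hJ') (exists_not_mem J J' (by omega) (by rintro rfl; omega))
      have := this hb
      simp only [LinearMap.mem_ker, AlgHom.toLinearMap_apply, map_mul] at this ⊢
      rw [this, mul_zero]
    exact this (CI_LZ X hX H n hv)
  have h3 : r ∈ CI K R ^ 3 := by
    refine step X hX θ hθ 1 (fun l => Wp (l.map X)) ?_ ?_ ?_ ?_ r ?_ hr0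
    · intro J _; exact Wp_CI _
    · exact hv 0
    · intro J p hJ
      refine ⟨24, by norm_num, ?_⟩
      rw [map_Wp _ _ (by simpa using hJ), hmap]
      exact Wp_el J p _ (by simpa using hJ) (by simp)
    · intro J p J' hJ hJ' hne
      change θ J p (Wp (J'.toList.map X)) = 0
      rw [map_Wp _ _ (by simpa using hJ'), hmap]
      exact Wp_el0 J p _ (by simpa using hJ') (exists_not_mem J J' (by omega) hne)
    · exact sup_le_sup_right (SW_LZ X) _ hr
  have hall : ∀ n, r ∈ CI K R ^ (n+3) := by
    intro n
    induction n with
    | zero => exact h3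
    | succ n ih =>
      refine step X hX θ hθ (n+2) (fun l => Zp (l.map X)) ?_ ?_ ?_ ?_ r ?_ hr0
      · intro J hJ; exact Zp_CI _ _ (by simpa using hJ)
      · exact hv (n+1)
      · intro J p hJ
        refine ⟨2 ^ (n+3), pow_ne_zero _ two_ne_zero, ?_⟩
        rw [map_Zp, hmap]
        exact Zp_el J p _ _ (by simpa using hJ) (by simp)
      · intro J p J' hJ hJ' hne
        rw [map_Zp, hmap]
        exact Zp_el0 J p (n+3) _ (by simpa using hJ') (exists_not_mem J J' (by omega) hne)
      · exact Submodule.mem_sup_left (CI_LZ X hX H n ih)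
  have hm := CI_LZ X hX H m (hall m)
  have he : {x : R | ∃ J : Finset (Fin m), J.card = 2 * (m+3) ∧ x = Zp (J.toList.map X)} = ∅ := by
    rw [Set.eq_empty_iff_forall_notMem]
    rintro _ ⟨J, hJ, _⟩
    have := Finset.card_le_univ J
    simp at this; omega
  rw [LZ, he] at hm
  simpa using hm
end step

section fin
variable {K : Type*} [Field K] [CharZero K] {m : ℕ}

/-- relations -/
inductive Rl (K : Type*) [Field K] (m : ℕ) : FreeAlgebra K (Fin m) → FreeAlgebra K (Fin m) → Prop
  | mk (a b c d e) : Rl K m (br a b * br c d * e) (e * (br a b * br c d))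

/-- the relatively free algebra -/
abbrev RR (K : Type*) [Field K] (m : ℕ) := RingQuot (Rl K m)

/-- projection -/
def rmk (K : Type*) [Field K] (m : ℕ) : FreeAlgebra K (Fin m) →ₐ[K] RR K m := RingQuot.mkAlgHom K (Rl K m)

lemma HH_RR : HH (RR K m) := by
  have hs : Function.Surjective (rmk K m) := RingQuot.mkAlgHom_surjective K _
  intro a b c d e
  obtain ⟨a, rfl⟩ := hs a
  obtain ⟨b, rfl⟩ := hs b
  obtain ⟨c, rfl⟩ := hs c
  obtain ⟨d, rfl⟩ := hs d
  obtain ⟨e, rfl⟩ := hs e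
  have := RingQuot.mkAlgHom_rel K (Rl.mk (K := K) (m := m) a b c d e)
  change rmk K m _ = rmk K m _ at this
  simpa only [map_mul, map_br] using this

lemma RR_gen : Algebra.adjoin K (Set.range (fun a => rmk K m (FreeAlgebra.ι K a))) = ⊤ := by
  have hs : Function.Surjective (rmk K m) := RingQuot.mkAlgHom_surjective K _
  have h := congrArg (Subalgebra.map (rmk K m)) (FreeAlgebra.adjoin_range_ι K (Fin m))
  rw [AlgHom.map_adjoin, Algebra.map_top, (AlgHom.range_eq_top _).2 hs, ← Set.range_comp] at h
  exact h

/-- lifting -/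
lemma RR_lift {S : Type*} [Ring S] [Algebra K S] (H : HH S) (g : FreeAlgebra K (Fin m) →ₐ[K] S) :
    ∃ θ : RR K m →ₐ[K] S, ∀ x, θ (rmk K m x) = g x := by
  refine ⟨RingQuot.liftAlgHom K ⟨g, ?_⟩, fun x => RingQuot.liftAlgHom_mkAlgHom_apply _ _ _ _⟩
  rintro _ _ ⟨a, b, c, d, e⟩
  simp only [map_mul, map_br]
  exact H _ _ _ _ _

lemma ee_odd (a : ℕ) : ee K a ∈ evenOdd (0 : QuadraticForm K (ℕ →₀ K)) 1 := ι_mem_evenOdd_one _ _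
lemma al_even (t : K) : algebraMap K (GrassmannAlg K) t ∈ evenOdd (0 : QuadraticForm K (ℕ →₀ K)) 0 :=
  SetLike.algebraMap_mem_graded (evenOdd (0 : QuadraticForm K (ℕ →₀ K))) t
lemma ite_odd (P : Prop) [Decidable P] (a : ℕ) :
    (if P then ee K a else 0) ∈ evenOdd (0 : QuadraticForm K (ℕ →₀ K)) 1 := by
  split_ifs
  · exact ee_odd a
  · exact zero_mem _

/-- symmetric matrices -/
def me (J : Finset (Fin m)) (p : Fin m → K) (a : Fin m) : M11 K :=
  ⟨!![algebraMap K _ (p a), if a ∈ J then ee K a else 0; if a ∈ J then ee K a else 0, algebraMap K _ (p a)],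
    al_even _, al_even _, ite_odd _ _, ite_odd _ _⟩

/-- matrix entries -/
def en (i j : Fin 2) : M11 K →ₗ[K] GrassmannAlg K where
  toFun A := A.1 i j
  map_add' _ _ := rfl
  map_smul' _ _ := rfl

lemma en_mul (i j : Fin 2) (A B : M11 K) : en i j (A * B) = en i 0 A * en 0 j B + en i 1 A * en 1 j B := by
  change (A.1 * B.1) i j = _
  rw [Matrix.mul_apply, Fin.sum_univ_two]; rfl

lemma en_al (i j : Fin 2) (t : K) : en i j (algebraMap K (M11 K) t) = if i = j then algebraMap K _ t else 0 := by
  change (algebraMap K (Matrix (Fin 2) (Fin 2) (GrassmannAlg K)) t) i j = _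
  rw [Matrix.algebraMap_matrix_apply]

lemma evE (J : Finset (Fin m)) (p : Fin m → K) (x : FreeAlgebra K (Fin m)) :
    en 0 0 (FreeAlgebra.lift K (me J p) x) + en 0 1 (FreeAlgebra.lift K (me J p) x) = FreeAlgebra.lift K (el J p) x ∧
    en 1 1 (FreeAlgebra.lift K (me J p) x) = en 0 0 (FreeAlgebra.lift K (me J p) x) ∧
    en 1 0 (FreeAlgebra.lift K (me J p) x) = en 0 1 (FreeAlgebra.lift K (me J p) x) := by
  induction x using FreeAlgebra.induction with
  | grade0 r => simp [AlgHom.commutes, en_al]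
  | grade1 a =>
    simp only [FreeAlgebra.lift_ι_apply]
    exact ⟨rfl, rfl, rfl⟩
  | mul a b ha hb =>
    obtain ⟨a1, a2, a3⟩ := ha
    obtain ⟨b1, b2, b3⟩ := hb
    simp only [map_mul, en_mul, a2, a3, b2, b3, ← a1, ← b1]
    refine ⟨by noncomm_ring, add_comm _ _, add_comm _ _⟩
  | add a b ha hb =>
    obtain ⟨a1, a2, a3⟩ := ha
    obtain ⟨b1, b2, b3⟩ := hb
    simp only [map_add, a2, a3, b2, b3, ← a1, ← b1]
    exact ⟨by abel, trivial, trivial⟩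

/-- matrices with two odd entries -/
def mtt (i j : Fin m) (v : Fin m ⊕ Fin m → K) (a : Fin m) : M11 K :=
  ⟨!![algebraMap K _ (v (Sum.inl a)), if a = i then ee K 0 else 0; if a = j then ee K 1 else 0,
    algebraMap K _ (v (Sum.inl a) + v (Sum.inr a))],
    al_even _, al_even _, ite_odd _ _, ite_odd _ _⟩

lemma evA (i j : Fin m) (v : Fin m ⊕ Fin m → K) (x : FreeAlgebra K (Fin m)) :
    en 0 0 (FreeAlgebra.lift K (mtt i j v) x) =
      (MvPolynomial.eval v (ent 0 0 (FreeAlgebra.lift K (tm K i j) x))) • (1 : GrassmannAlg K)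
      + (MvPolynomial.eval v (ent 0 2 (FreeAlgebra.lift K (tm K i j) x))) • (ee K 0 * ee K 1) ∧
    en 0 1 (FreeAlgebra.lift K (mtt i j v) x) =
      (MvPolynomial.eval v (ent 0 1 (FreeAlgebra.lift K (tm K i j) x))) • ee K 0 ∧
    en 1 0 (FreeAlgebra.lift K (mtt i j v) x) =
      (MvPolynomial.eval v (ent 1 2 (FreeAlgebra.lift K (tm K i j) x))) • ee K 1 ∧
    ∃ s : K, en 1 1 (FreeAlgebra.lift K (mtt i j v) x) =
      (MvPolynomial.eval v (ent 1 1 (FreeAlgebra.lift K (tm K i j) x))) • (1 : GrassmannAlg K)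
      + s • (ee K 0 * ee K 1) := by
  induction x using FreeAlgebra.induction with
  | grade0 r =>
    have h : ∀ k l, ent k l (algebraMap K (UT K (PP K m)) r) = if k = l then algebraMap K _ r else 0 := by
      intro k l
      change (algebraMap K (Matrix (Fin 3) (Fin 3) (PP K m)) r) k l = _
      rw [Matrix.algebraMap_matrix_apply]
    have h1 : MvPolynomial.eval v (algebraMap K (PP K m) r) = r := by
      rw [MvPolynomial.algebraMap_eq, MvPolynomial.eval_C]
    simp only [AlgHom.commutes, en_al, h]
    refine ⟨?_, ?_, ?_, 0, ?_⟩ <;> simp [h1, Algebra.algebraMap_eq_smul_one]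
  | grade1 a =>
    simp only [FreeAlgebra.lift_ι_apply, ent_ap, tm_val]
    refine ⟨?_, ?_, ?_, 0, ?_⟩
    · change algebraMap K _ (v (Sum.inl a)) = _
      simp [Algebra.algebraMap_eq_smul_one]
    · change (if a = i then ee K 0 else 0) = _
      split_ifs <;> simp
    · change (if a = j then ee K 1 else 0) = _
      split_ifs <;> simp
    · change algebraMap K _ (v (Sum.inl a) + v (Sum.inr a)) = _
      simp [Algebra.algebraMap_eq_smul_one, yv]
  | mul a b ha hb =>
    obtain ⟨a1, a2, a3, s, a4⟩ := ha
    obtain ⟨b1, b2, b3, t, b4⟩ := hb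
    have q00 := ee_sq (K := K) 0
    have q11 := ee_sq (K := K) 1
    have q10 := ee_swap (K := K) 1 0
    simp only [map_mul, en_mul, ent00, ent01, ent02, ent11, ent12, a1, a2, a3, a4, b1, b2, b3, b4,
      map_add]
    generalize ee K 0 = e at *
    generalize ee K 1 = f at *
    have q1 : e * f * (e * f) = 0 := by
      rw [mul_assoc, ← mul_assoc f, q10, neg_mul, mul_assoc, q11, mul_zero, neg_zero, mul_zero]
    have q2 : e * f * e = 0 := by
      rw [mul_assoc, q10, mul_neg, ← mul_assoc, q00, zero_mul, neg_zero]
    have q3 : e * (e * f) = 0 := by rw [← mul_assoc, q00, zero_mul]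
    have q4 : e * f * f = 0 := by rw [mul_assoc, q11, mul_zero]
    have q5 : f * (e * f) = 0 := by rw [← mul_assoc, q10, neg_mul, mul_assoc, q11, mul_zero, neg_zero]
    generalize MvPolynomial.eval v (ent 0 0 (FreeAlgebra.lift K (tm K i j) a)) = A0 at *
    generalize MvPolynomial.eval v (ent 0 0 (FreeAlgebra.lift K (tm K i j) b)) = B0 at *
    generalize MvPolynomial.eval v (ent 0 1 (FreeAlgebra.lift K (tm K i j) a)) = A1 at *
    generalize MvPolynomial.eval v (ent 0 1 (FreeAlgebra.lift K (tm K i j) b)) = B1 at *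
    generalize MvPolynomial.eval v (ent 0 2 (FreeAlgebra.lift K (tm K i j) a)) = A2 at *
    generalize MvPolynomial.eval v (ent 0 2 (FreeAlgebra.lift K (tm K i j) b)) = B2 at *
    generalize MvPolynomial.eval v (ent 1 1 (FreeAlgebra.lift K (tm K i j) a)) = A3 at *
    generalize MvPolynomial.eval v (ent 1 1 (FreeAlgebra.lift K (tm K i j) b)) = B3 at *
    generalize MvPolynomial.eval v (ent 1 2 (FreeAlgebra.lift K (tm K i j) a)) = A4 at *
    generalize MvPolynomial.eval v (ent 1 2 (FreeAlgebra.lift K (tm K i j) b)) = B4 at *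
    refine ⟨?_, ?_, ?_, A3 * t + s * B3 - A4 * B1, ?_⟩ <;>
      simp only [add_mul, mul_add, smul_mul_smul_comm, one_mul, mul_one, q00, q11, q10, q1, q2, q3, q4, q5,
        smul_zero, add_zero, zero_add, smul_neg] <;> module
  | add a b ha hb =>
    obtain ⟨a1, a2, a3, s, a4⟩ := ha
    obtain ⟨b1, b2, b3, t, b4⟩ := hb
    simp only [map_add, a1, a2, a3, a4, b1, b2, b3, b4]
    refine ⟨?_, ?_, ?_, s + t, ?_⟩ <;> module

lemma main_zero (x : FreeAlgebra K (Fin m)) (hx : ∀ φ : FreeAlgebra K (Fin m) →ₐ[K] M11 K, φ x = 0) :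
    rmk K m x = 0 := by
  choose θ hθ using fun (J : Finset (Fin m)) (p : Fin m → K) => RR_lift HH_E (FreeAlgebra.lift K (el J p))
  choose η hη using fun (i j : Fin m) => RR_lift HH_UT (FreeAlgebra.lift K (tm K i j))
  obtain ⟨ab, hab⟩ := RR_lift (K := K) (m := m) (S := MvPolynomial (Fin m) K)
    (fun a b c d e => mul_comm _ _) (FreeAlgebra.lift K MvPolynomial.X)
  have hE : ∀ J p, θ J p (rmk K m x) = 0 := by
    intro J p
    rw [hθ, ← (evE J p x).1, hx, map_zero, map_zero, add_zero]
  have hw : ee K 0 * ee K 1 ≠ 0 := by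
    have := ee_ne (K := K) [0, 1] (by simp)
    simpa using this
  have hA : ∀ i j v, MvPolynomial.eval v (ent 0 1 (η i j (rmk K m x))) = 0 ∧
      MvPolynomial.eval v (ent 0 2 (η i j (rmk K m x))) = 0 := by
    intro i j v
    obtain ⟨h1, h2, -⟩ := evA i j v x
    rw [hx, map_zero] at h1 h2
    rw [hη]
    have e0 : ee K 0 ≠ 0 := fun h => hw (by rw [h, zero_mul])
    refine ⟨by simpa [e0] using h2.symm, ?_⟩
    have q10 := ee_swap (K := K) 1 0
    have q1 : ee K 0 * ee K 1 * (ee K 0 * ee K 1) = 0 := by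
      rw [mul_assoc, ← mul_assoc (ee K 1), q10, neg_mul, mul_assoc, ee_sq, mul_zero, neg_zero, mul_zero]
    have h3 := congrArg (fun z => z * (ee K 0 * ee K 1)) h1
    simp only [zero_mul, add_mul, smul_mul_assoc, one_mul, q1, smul_zero, add_zero] at h3
    have h4 := (smul_eq_zero.1 h3.symm).resolve_right hw
    rw [h4, zero_smul, zero_add] at h1
    exact (smul_eq_zero.1 h1.symm).resolve_right hw
  have h0 : ab (rmk K m x) = 0 := by
    apply MvPolynomial.funext
    intro p
    have h1 : FreeAlgebra.lift K (el ∅ p) = ((Algebra.ofId K (GrassmannAlg K)).comp (MvPolynomial.aeval p)).comp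
        (FreeAlgebra.lift K (MvPolynomial.X (R := K) (σ := Fin m))) := by
      ext a
      simp [el, Algebra.ofId_apply]
    have h2 := hE ∅ p
    rw [hθ, h1] at h2
    rw [hab, map_zero]
    have h3 : algebraMap K (GrassmannAlg K) (MvPolynomial.eval p (FreeAlgebra.lift K MvPolynomial.X x)) = 0 := by
      simpa [Algebra.ofId_apply, MvPolynomial.aeval_def, MvPolynomial.eval₂_eq_eval_map] using h2
    exact (map_eq_zero_iff _ (FaithfulSMul.algebraMap_injective K _)).1 h3
  have hs := level012 (fun a => rmk K m (FreeAlgebra.ι K a)) RR_gen HH_RR ab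
    (fun a => by rw [hab, FreeAlgebra.lift_ι_apply]) η (fun i j a => by rw [hη, FreeAlgebra.lift_ι_apply])
    (rmk K m x) h0 (fun i j => MvPolynomial.funext fun v => by rw [(hA i j v).1, map_zero])
    (fun i j => MvPolynomial.funext fun v => by rw [(hA i j v).2, map_zero])
  exact level_top _ RR_gen HH_RR θ (fun J p a => by rw [hθ, FreeAlgebra.lift_ι_apply]) _ hs hE

/-- inclusion of finitely many variables -/
def gi (K : Type*) [Field K] (m : ℕ) : FreeAlgebra K (Fin m) →ₐ[K] FreeAlgebra K ℕ :=
  FreeAlgebra.lift K (fun a => FreeAlgebra.ι K (a : ℕ))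

lemma gi_mono {m n : ℕ} (h : m ≤ n) : (gi K m).range ≤ (gi K n).range := by
  have : gi K m = (gi K n).comp (FreeAlgebra.lift K (fun a => FreeAlgebra.ι K (Fin.castLE h a))) := by
    ext a; simp [gi]
  rw [this]; exact AlgHom.range_comp_le_range _ _

lemma gi_ex (f : FreeAlgebra K ℕ) : ∃ m, f ∈ (gi K m).range := by
  induction f using FreeAlgebra.induction with
  | grade0 r => exact ⟨0, Subalgebra.algebraMap_mem _ r⟩
  | grade1 a => exact ⟨a + 1, FreeAlgebra.ι K (Fin.last a), by simp [gi]⟩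
  | mul a b ha hb =>
    obtain ⟨m, hm⟩ := ha
    obtain ⟨n, hn⟩ := hb
    exact ⟨max m n, mul_mem (gi_mono (le_max_left _ _) hm) (gi_mono (le_max_right _ _) hn)⟩
  | add a b ha hb =>
    obtain ⟨m, hm⟩ := ha
    obtain ⟨n, hn⟩ := hb
    exact ⟨max m n, add_mem (gi_mono (le_max_left _ _) hm) (gi_mono (le_max_right _ _) hn)⟩

lemma HH_U (a b c d e : FreeAlgebra K ℕ) :
    br a b * br c d * e - e * (br a b * br c d) ∈ TIdealGen K {p₁ K} := by
  refine TwoSidedIdeal.subset_span ⟨p₁ K, rfl, FreeAlgebra.lift K (fun n => match n with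
    | 0 => a | 1 => b | 2 => c | 3 => d | _ => e), ?_⟩
  simp [p₁, br, tv]

theorem main_thm (K : Type*) [Field K] [CharZero K] :
    polyIdentities K (M11 K) ⊆ (TIdealGen K {p₁ K} : Set (FreeAlgebra K ℕ)) := by
  intro f hf
  obtain ⟨m, y, rfl⟩ := gi_ex f
  have h0 : rmk K m y = 0 := by
    apply main_zero
    intro φ
    have h1 := hf (FreeAlgebra.lift K (fun n => if h : n < m then φ (FreeAlgebra.ι K ⟨n, h⟩) else 0))
    have h2 : (FreeAlgebra.lift K (fun n => if h : n < m then φ (FreeAlgebra.ι K ⟨n, h⟩) else 0)).comp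
        (gi K m) = φ := by
      ext a : 2
      simp [gi]
    rw [← h2]; exact h1
  let U := TIdealGen K {p₁ K}
  let g : FreeAlgebra K (Fin m) →+* U.ringCon.Quotient := U.ringCon.mk'.comp (gi K m).toRingHom
  have hg : ∀ ⦃x z⦄, Rl K m x z → g x = g z := by
    rintro _ _ ⟨a, b, c, d, e⟩
    change ((gi K m (br a b * br c d * e) : FreeAlgebra K ℕ) : U.ringCon.Quotient) =
      ((gi K m (e * (br a b * br c d)) : FreeAlgebra K ℕ) : U.ringCon.Quotient)
    rw [RingCon.eq, TwoSidedIdeal.rel_iff]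
    simp only [map_mul, map_br]
    exact HH_U _ _ _ _ _
  have h3 : RingQuot.lift ⟨g, hg⟩ (rmk K m y) = g y := by
    rw [rmk, ← RingQuot.lift_mkRingHom_apply g hg]
    congr 1
    exact congrArg (fun F : _ →+* _ => F y) (RingQuot.mkAlgHom_coe K (Rl K m))
  rw [h0, map_zero] at h3
  have h4 : ((gi K m y : FreeAlgebra K ℕ) : U.ringCon.Quotient) = ((0 : FreeAlgebra K ℕ) : U.ringCon.Quotient) := h3.symm
  rw [RingCon.eq] at h4
  exact (TwoSidedIdeal.mem_iff _ _).2 h4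
end fin


/- STATEMENT 8: every polynomial identity of M11(E) is a consequence of
[[t1,t2][t3,t4],t5]: T(M11(E)) is contained in the T-ideal generated by this polynomial. -/
theorem stmt8 (K : Type*) [Field K] [CharZero K] :
    polyIdentities K (M11 K) ⊆ (TIdealGen K {p₁ K} : Set (FreeAlgebra K ℕ)) := by
  exact main_thm K
end
end

section
/- For every integer n >= 4, each of the three polynomials [t1,t2,t1^(n-1)], [t1,t2][t3,t1^(n-2)] - [t1,t3][t2,t1^(n-2)], and [t1,t2][t1,t2,t1^(n-3)] belongs to the T-ideal generated by [t1,t2,t1^(n-2)] together with the three polynomials [[t1,t2][t3,t4],t5], [t1,t2][t3,t4][t5,t6], and s4(t1,t2,t3,t4). -/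
noncomputable section

/-- `adIter c l z` is the left-normed commutator `[z, c^{(l)}] = [z, c, ..., c]`
with `l` occurrences of `c`. -/
def adIter {A : Type*} [Ring A] (c : A) (l : ℕ) (z : A) : A :=
  (fun w => w * c - c * w)^[l] z

/-- The standard polynomial `s4(t1,t2,t3,t4)`. -/
def s4poly (K : Type*) [Field K] : FreeAlgebra K ℕ :=
  ∑ σ : Equiv.Perm (Fin 4), (Equiv.Perm.sign σ : ℤ) •
    (tv K (σ 0) * tv K (σ 1) * tv K (σ 2) * tv K (σ 3))

/-- The polynomial `[t1,t2][t3,t4][t5,t6]`. -/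
def p₂ (K : Type*) [Field K] : FreeAlgebra K ℕ :=
  br (tv K 0) (tv K 1) * br (tv K 2) (tv K 3) * br (tv K 4) (tv K 5)

theorem adIter_succ_aux {A : Type*} [Ring A] (c : A) (l : ℕ) (z : A) :
    adIter c (l + 1) z = adIter c l z * c - c * adIter c l z := by
  simp only [adIter, Function.iterate_succ_apply']

theorem adIter_zero_aux {A : Type*} [Ring A] (c z : A) : adIter c 0 z = z := rfl

theorem adIter_br_aux {A : Type*} [Ring A] (c y : A) (l : ℕ) :
    adIter c l (br c y) = - adIter c (l + 1) y := by
  induction l with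
  | zero => simp [adIter_succ_aux, adIter_zero_aux, br]
  | succ l ih => rw [adIter_succ_aux, ih, adIter_succ_aux c (l + 1)]; noncomm_ring

theorem map_adIter_aux {A B : Type*} [Ring A] [Ring B] (f : A →+* B) (c z : A) (l : ℕ) :
    f (adIter c l z) = adIter (f c) l (f z) := by
  induction l with
  | zero => rfl
  | succ l ih => rw [adIter_succ_aux, adIter_succ_aux, map_sub, map_mul, map_mul, ih]

theorem map_br_aux {A B : Type*} [Ring A] [Ring B] (f : A →+* B) (a b : A) :
    f (br a b) = br (f a) (f b) := by
  simp [br]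

/-- The part of `[y, (x+w)^(m)]` that is linear in `w`. -/
def linPart {A : Type*} [Ring A] (x y w : A) : ℕ → A
  | 0 => 0
  | m + 1 => linPart x y w m * x - x * linPart x y w m + (adIter x m y * w - w * adIter x m y)

theorem coeffs_zero_aux {K V : Type*} [Field K] [CharZero K] [AddCommGroup V] [Module K V]
    (m : ℕ) (v : ℕ → V) (h : ∀ c : K, ∑ k ∈ Finset.range m, c ^ k • v k = 0)
    (k : ℕ) (hk : k < m) : v k = 0 := by
  rw [← Module.forall_dual_apply_eq_zero_iff K]
  intro f
  have hp : (∑ k ∈ Finset.range m, Polynomial.monomial k (f (v k)) : Polynomial K) = 0 := by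
    apply Polynomial.funext
    intro c
    have := congrArg f (h c)
    simp only [map_sum, map_smul, smul_eq_mul, map_zero] at this
    simp only [Polynomial.eval_finsetSum, Polynomial.eval_monomial, Polynomial.eval_zero]
    rw [← this]
    exact Finset.sum_congr rfl fun _ _ => mul_comm _ _
  have := congrArg (fun p => Polynomial.coeff p k) hp
  simpa [Polynomial.finsetSum_coeff, Polynomial.coeff_monomial, hk] using this

theorem expand_aux (K : Type*) {A : Type*} [Field K] [Ring A] [Algebra K A] (x y w : A) (m : ℕ) :
    ∃ v : ℕ → A, v 0 = adIter x m y ∧ v 1 = linPart x y w m ∧ (∀ k, m < k → v k = 0) ∧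
      ∀ c : K, adIter (x + c • w) m y = ∑ k ∈ Finset.range (m + 1), c ^ k • v k := by
  induction m with
  | zero =>
    refine ⟨fun k => if k = 0 then y else 0, ?_, ?_, ?_, ?_⟩
    · simp [adIter_zero_aux]
    · simp [linPart]
    · intro k hk; simp [hk.ne']
    · intro c; simp [adIter_zero_aux]
  | succ m ih =>
    obtain ⟨v, h0, h1, hv, h⟩ := ih
    refine ⟨fun k => (v k * x - x * v k) +
      (match k with | 0 => 0 | k + 1 => v k * w - w * v k), ?_, ?_, ?_, ?_⟩
    · simp [h0, adIter_succ_aux]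
    · simp [h0, h1, linPart]
    · intro k hk
      obtain ⟨k, rfl⟩ : ∃ j, k = j + 1 := ⟨k - 1, by omega⟩
      simp [hv (k + 1) (by omega), hv k (by omega)]
    · intro c
      rw [adIter_succ_aux, h c]
      simp only [smul_add, Finset.sum_add_distrib]
      rw [Finset.sum_range_succ _ (m + 1), hv (m + 1) (by omega),
        Finset.sum_range_succ' (fun k => c ^ k • (match k with | 0 => 0 | k + 1 => v k * w - w * v k : A))]
      simp only [mul_add, add_mul, Finset.sum_mul, Finset.mul_sum, smul_sub,
        Finset.sum_sub_distrib, smul_mul_assoc, mul_smul_comm, pow_succ, mul_smul, smul_zero,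
        zero_mul, mul_zero, sub_zero, add_zero, Finset.smul_sum, smul_add, Finset.sum_add_distrib]
      have sw : ∀ (k : ℕ) (z : A), c • c ^ k • z = c ^ k • c • z := fun k z => smul_comm _ _ _
      simp only [sw]
      abel

theorem key_aux (K : Type*) {A : Type*} [Field K] [CharZero K] [Ring A] [Algebra K A]
    (N : ℕ) (hN : 1 ≤ N) (H1 : ∀ x y : A, adIter x (N + 1) y = 0)
    (H2 : ∀ a b c d e : A, br (br a b * br c d) e = 0) (x y u : A) :
    adIter x 1 y * adIter x N u = 0 := by
  have lin : ∀ w, linPart x y w (N + 1) = 0 := by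
    intro w
    obtain ⟨v, -, h1, -, h⟩ := expand_aux K x y w (N + 1)
    rw [← h1]
    refine coeffs_zero_aux (K := K) (N + 2) v (fun c => ?_) 1 (by omega)
    rw [← h c, H1]
  have cen : ∀ i j, adIter x (i + 1) y * adIter x (j + 1) u * x
      - x * (adIter x (i + 1) y * adIter x (j + 1) u) = 0 := fun i j => by
    rw [adIter_succ_aux x i, adIter_succ_aux x j]
    exact H2 _ _ _ _ _
  have shift : ∀ i j, adIter x (i + 2) y * adIter x (j + 1) u
      = - (adIter x (i + 1) y * adIter x (j + 2) u) := fun i j => by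
    have := cen i j
    rw [adIter_succ_aux x (i + 1), adIter_succ_aux x (j + 1), eq_neg_iff_add_eq_zero, ← this]
    noncomm_ring
  have form : ∀ m : ℕ, linPart x y (x * u) (m + 1) = x * linPart x y u (m + 1)
      + ((m + 1 : ℕ) • (adIter x (m + 1) y * u) + m • (adIter x m y * adIter x 1 u)) := by
    intro m
    induction m with
    | zero => simp [linPart, adIter_succ_aux, adIter_zero_aux]; noncomm_ring
    | succ m ih =>
      rw [linPart, ih, linPart.eq_2 x y u (m + 1)]
      have c0 : m • (adIter x m y * adIter x 1 u) * x - x * (m • (adIter x m y * adIter x 1 u)) = 0 := by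
        cases m with
        | zero => simp
        | succ m =>
          rw [smul_mul_assoc, mul_smul_comm, ← smul_sub, cen m 0, smul_zero]
      generalize m • (adIter x m y * adIter x 1 u) = q at *
      rw [adIter_succ_aux x (m + 1) y, adIter_succ_aux x 0 u, adIter_zero_aux]
      generalize adIter x (m + 1) y = z at *
      generalize linPart x y u (m + 1) = p at *
      rw [← sub_eq_zero, ← c0]
      simp only [add_smul, one_smul, nsmul_eq_mul]
      have hc := Nat.cast_commute m x
      generalize (m : A) = k at *
      have := hc.eq
      simp only [mul_add, add_mul, mul_sub, sub_mul, ← mul_assoc, ← hc.eq]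
      noncomm_ring
  have e1 := form N
  rw [lin, lin, H1] at e1
  simp only [mul_zero, zero_mul, smul_zero, zero_add] at e1
  have e2 : adIter x N y * adIter x 1 u = 0 := by
    have h3 : (N : K) • (adIter x N y * adIter x 1 u) = 0 := by
      rw [Nat.cast_smul_eq_nsmul]; exact e1.symm
    rcases smul_eq_zero.1 h3 with h | h
    · exact absurd (Nat.cast_eq_zero.1 h) (by omega)
    · exact h
  have fin : ∀ i j, adIter x (i + 1) y * adIter x (j + 1) u = 0 →
      adIter x 1 y * adIter x (i + j + 1) u = 0 := by
    intro i
    induction i with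
    | zero => intro j h; simpa using h
    | succ i ih =>
      intro j h
      rw [shift, neg_eq_zero] at h
      have := ih (j + 1) h
      rwa [show i + 1 + j + 1 = i + (j + 1) + 1 by ring]
  obtain ⟨M, rfl⟩ : ∃ M, N = M + 1 := ⟨N - 1, by omega⟩
  exact fin M 0 e2

theorem stmt9 (K : Type*) [Field K] [CharZero K] (n : ℕ) (hn : 4 ≤ n) :
    adIter (tv K 0) (n - 1) (br (tv K 0) (tv K 1)) ∈
      TIdealGen K {adIter (tv K 0) (n - 2) (br (tv K 0) (tv K 1)), p₁ K, p₂ K, s4poly K}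
    ∧ br (tv K 0) (tv K 1) * adIter (tv K 0) (n - 2) (tv K 2)
        - br (tv K 0) (tv K 2) * adIter (tv K 0) (n - 2) (tv K 1) ∈
      TIdealGen K {adIter (tv K 0) (n - 2) (br (tv K 0) (tv K 1)), p₁ K, p₂ K, s4poly K}
    ∧ br (tv K 0) (tv K 1) * adIter (tv K 0) (n - 3) (br (tv K 0) (tv K 1)) ∈
      TIdealGen K {adIter (tv K 0) (n - 2) (br (tv K 0) (tv K 1)), p₁ K, p₂ K, s4poly K} := by
  obtain ⟨M, rfl⟩ : ∃ M, n = M + 3 := ⟨n - 3, by omega⟩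
  simp only [show M + 3 - 1 = M + 2 by omega, show M + 3 - 2 = M + 1 by omega,
    show M + 3 - 3 = M by omega]
  generalize hI : TIdealGen K {adIter (tv K 0) (M + 1) (br (tv K 0) (tv K 1)), p₁ K, p₂ K,
    s4poly K} = I
  let q : FreeAlgebra K ℕ →+* I.ringCon.Quotient := I.ringCon.mk'
  have hq : ∀ a, a ∈ I ↔ q a = 0 := by
    intro a
    rw [TwoSidedIdeal.mem_iff, ← RingCon.eq]
    rfl
  have hs : Function.Surjective q := I.ringCon.mk'_surjective
  have gen : ∀ f ∈ ({adIter (tv K 0) (M + 1) (br (tv K 0) (tv K 1)), p₁ K, p₂ K,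
      s4poly K} : Set (FreeAlgebra K ℕ)), ∀ φ : FreeAlgebra K ℕ →ₐ[K] FreeAlgebra K ℕ,
      q (φ f) = 0 := by
    intro f hf φ
    rw [← hq, ← hI]
    exact TwoSidedIdeal.subset_span ⟨f, hf, φ, rfl⟩
  have H1 : ∀ x y : I.ringCon.Quotient, adIter x (M + 1 + 1) y = 0 := by
    intro x y
    obtain ⟨x, rfl⟩ := hs x
    obtain ⟨y, rfl⟩ := hs y
    have := gen _ (Or.inl rfl) (FreeAlgebra.lift K (fun i => if i = 0 then x else y))
    rw [adIter_br_aux, map_neg, map_neg, neg_eq_zero] at this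
    have e := map_adIter_aux (FreeAlgebra.lift K (fun i => if i = 0 then x else y)).toRingHom
      (tv K 0) (tv K 1) (M + 1 + 1)
    simp only [AlgHom.toRingHom_eq_coe, RingHom.coe_coe] at e
    rw [e, map_adIter_aux] at this
    simpa [tv] using this
  have H2 : ∀ a b c d e : I.ringCon.Quotient, br (br a b * br c d) e = 0 := by
    intro a b c d e
    obtain ⟨a, rfl⟩ := hs a
    obtain ⟨b, rfl⟩ := hs b
    obtain ⟨c, rfl⟩ := hs c
    obtain ⟨d, rfl⟩ := hs d
    obtain ⟨e, rfl⟩ := hs e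
    have := gen (p₁ K) (by simp) (FreeAlgebra.lift K (fun i => if i = 0 then a else
      if i = 1 then b else if i = 2 then c else if i = 3 then d else e))
    simpa [p₁, br, tv] using this
  have key := key_aux K (M + 1) (by omega) H1 H2
  have b1 : ∀ x y : I.ringCon.Quotient, br x y = - adIter x 1 y :=
    fun x y => adIter_br_aux x y 0
  refine ⟨?_, ?_, ?_⟩
  · rw [hq, adIter_br_aux, map_neg, map_adIter_aux, adIter_succ_aux, H1]
    simp
  · rw [hq, map_sub, map_mul, map_mul, map_adIter_aux, map_adIter_aux, map_br_aux, map_br_aux,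
      b1, b1, neg_mul, neg_mul, key, key]
    simp
  · rw [hq, map_mul, map_adIter_aux, map_br_aux, adIter_br_aux, b1, neg_mul_neg, key]
end
end

section
/- For every integer n >= 4, the two polynomials [t1,t2][t1,t2,t1^(n-3)] and [t1,t2][t3,t1^(n-2)] - [t1,t3][t2,t1^(n-2)] belong to the T-ideal generated by [t1,t2][t1,t2,t1^(n-4)] together with the three polynomials [[t1,t2][t3,t4],t5], [t1,t2][t3,t4][t5,t6], and s4(t1,t2,t3,t4). -/
noncomputable section

theorem adIter_add' {A : Type*} [Ring A] (c : A) (l : ℕ) (y z : A) :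
    adIter c l (y + z) = adIter c l y + adIter c l z := by
  induction l with
  | zero => rfl
  | succ k ih =>
    unfold adIter at *
    simp only [Function.iterate_succ_apply', ih]
    noncomm_ring

theorem adIter_neg' {A : Type*} [Ring A] (c : A) (l : ℕ) (y : A) :
    adIter c l (-y) = -adIter c l y := by
  induction l with
  | zero => rfl
  | succ k ih =>
    unfold adIter at *
    simp only [Function.iterate_succ_apply', ih]
    noncomm_ring

theorem adIter_mul_self {A : Type*} [Ring A] (c : A) (l : ℕ) (y : A) :
    adIter c l (y * c) = adIter c l y * c := by
  induction l with
  | zero => rfl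
  | succ k ih =>
    unfold adIter at *
    simp only [Function.iterate_succ_apply', ih]
    noncomm_ring

theorem adIter_succ_out {A : Type*} [Ring A] (c : A) (l : ℕ) (y : A) :
    adIter c (l + 1) y = adIter c l y * c - c * adIter c l y := by
  unfold adIter
  simp only [Function.iterate_succ_apply']

theorem adIter_succ_in {A : Type*} [Ring A] (c : A) (l : ℕ) (y : A) :
    adIter c (l + 1) y = -adIter c l (br c y) := by
  rw [← adIter_neg']
  unfold adIter br
  rw [Function.iterate_succ_apply, neg_sub]

theorem map_adIter' {K A : Type*} [Field K] [Ring A] [Algebra K A] (φ : A →ₐ[K] A)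
    (c : A) (l : ℕ) (y : A) : φ (adIter c l y) = adIter (φ c) l (φ y) := by
  induction l with
  | zero => rfl
  | succ k ih => rw [adIter_succ_out, adIter_succ_out, map_sub, map_mul, map_mul, ih]

theorem key_mem {A : Type*} [Ring A] (I : TwoSidedIdeal A) (x : A) (m : ℕ)
    (h : ∀ y, br x y * adIter x m (br x y) ∈ I) (y z : A) :
    br x z * adIter x (m + 1) (br x y) ∈ I := by
  have hadd : ∀ y z : A, br x (y + z) = br x y + br x z := by
    intro y z; unfold br; noncomm_ring
  have hmul : ∀ z : A, br x (z * x) = br x z * x := by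
    intro z; unfold br; noncomm_ring
  have lin : ∀ y z : A,
      br x y * adIter x m (br x z) + br x z * adIter x m (br x y) ∈ I := by
    intro y z
    have h1 := I.sub_mem (I.sub_mem (h (y + z)) (h y)) (h z)
    rw [hadd, adIter_add'] at h1
    convert h1 using 1
    noncomm_ring
  have h2 := I.sub_mem (I.mul_mem_right _ x (lin y z)) (lin y (z * x))
  rw [hmul, adIter_mul_self] at h2
  rw [adIter_succ_out]
  convert h2 using 1
  noncomm_ring

/- STATEMENT 10: for n ≥ 4, the polynomials [t1,t2][t1,t2,t1^(n-3)] and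
[t1,t2][t3,t1^(n-2)] - [t1,t3][t2,t1^(n-2)] belong to the T-ideal generated by
[t1,t2][t1,t2,t1^(n-4)] together with [[t1,t2][t3,t4],t5], [t1,t2][t3,t4][t5,t6] and s4. -/
theorem stmt10 (K : Type*) [Field K] [CharZero K] (n : ℕ) (hn : 4 ≤ n) :
    br (tv K 0) (tv K 1) * adIter (tv K 0) (n - 3) (br (tv K 0) (tv K 1)) ∈
      TIdealGen K {br (tv K 0) (tv K 1) * adIter (tv K 0) (n - 4) (br (tv K 0) (tv K 1)),
        p₁ K, p₂ K, s4poly K}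
    ∧ br (tv K 0) (tv K 1) * adIter (tv K 0) (n - 2) (tv K 2)
        - br (tv K 0) (tv K 2) * adIter (tv K 0) (n - 2) (tv K 1) ∈
      TIdealGen K {br (tv K 0) (tv K 1) * adIter (tv K 0) (n - 4) (br (tv K 0) (tv K 1)),
        p₁ K, p₂ K, s4poly K} := by
  obtain ⟨m, rfl⟩ : ∃ m, n = m + 4 := ⟨n - 4, by omega⟩
  have e2 : m + 4 - 2 = m + 1 + 1 := by omega
  have e3 : m + 4 - 3 = m + 1 := by omega
  have e4 : m + 4 - 4 = m := by omega
  rw [e2, e3, e4]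
  set S : Set (FreeAlgebra K ℕ) :=
    {br (tv K 0) (tv K 1) * adIter (tv K 0) m (br (tv K 0) (tv K 1)),
        p₁ K, p₂ K, s4poly K} with hS
  have h : ∀ y, br (tv K 0) y * adIter (tv K 0) m (br (tv K 0) y) ∈ TIdealGen K S := by
    intro y
    apply TwoSidedIdeal.subset_span
    refine ⟨_, Set.mem_insert _ _,
      FreeAlgebra.lift K (fun i => if i = 0 then tv K 0 else y), ?_⟩
    rw [map_mul, map_adIter']
    simp [br, tv]
  refine ⟨key_mem _ _ m h _ _, ?_⟩
  rw [adIter_succ_in _ _ (tv K 2), adIter_succ_in _ _ (tv K 1), mul_neg, mul_neg]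
  exact (TIdealGen K S).sub_mem ((TIdealGen K S).neg_mem (key_mem _ _ m h _ _))
    ((TIdealGen K S).neg_mem (key_mem _ _ m h _ _))
end
end

section
/- For each k in {0, 1} and each integer l >= 0, the polynomial d_{k,l} = [x,y]^k [x,y,x^(l)] is not a polynomial identity of M11(E): there exist elements a, b in M11(E) such that [a,b]^k * [a,b,a^(l)] is not zero. -/
noncomputable section

open CliffordAlgebra

theorem aux_uv (K : Type*) [Field K] :
    ExteriorAlgebra.ι K (Finsupp.single 0 1 : ℕ →₀ K) *
      ExteriorAlgebra.ι K (Finsupp.single 1 1 : ℕ →₀ K) ≠ 0 := by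
  intro h
  have h2 := congrArg (fun z => CliffordAlgebra.contractLeft (Q := (0 : QuadraticForm K (ℕ →₀ K)))
    (Finsupp.lapply 0 : (ℕ →₀ K) →ₗ[K] K) z) h
  simp only [ExteriorAlgebra.ι] at h2
  rw [CliffordAlgebra.contractLeft_ι_mul, CliffordAlgebra.contractLeft_ι] at h2
  simp only [Finsupp.lapply_apply, Finsupp.single_eq_same, one_smul, map_zero] at h2
  rw [Finsupp.single_eq_of_ne (by decide)] at h2
  simp only [map_zero, mul_zero, sub_zero] at h2
  have h3 := (ExteriorAlgebra.ι_eq_zero_iff (R := K) (Finsupp.single 1 1 : ℕ →₀ K)).1 h2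
  simp at h3

theorem aux_iter {R : Type*} [Ring R] (u v : R) (l : ℕ) :
    adIter (!![1, 0; 0, 0] : Matrix (Fin 2) (Fin 2) R) l !![0, u; -v, 0] =
      !![0, (-1) ^ l * u; -v, 0] := by
  induction l with
  | zero => simp [adIter]
  | succ n ih =>
    unfold adIter at ih ⊢
    rw [Function.iterate_succ_apply', ih]
    ext i j
    fin_cases i <;> fin_cases j <;> simp [Matrix.mul_apply, Fin.sum_univ_two, pow_succ]

/- STATEMENT 14: for k ∈ {0,1} and every l ≥ 0, the polynomial
d_{k,l} = [x,y]^k [x,y,x^(l)] is not a polynomial identity of M11(E). -/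
theorem stmt14 (K : Type*) [Field K] [CharZero K] (k : ℕ) (hk : k = 0 ∨ k = 1) (l : ℕ) :
    ∃ a b : Matrix (Fin 2) (Fin 2) (GrassmannAlg K),
      a ∈ M11 K ∧ b ∈ M11 K ∧
      (a * b - b * a) ^ k * adIter a l (a * b - b * a) ≠ 0 := by
  have huv := aux_uv K
  set u := ExteriorAlgebra.ι K (Finsupp.single 0 1 : ℕ →₀ K) with hu
  set v := ExteriorAlgebra.ι K (Finsupp.single 1 1 : ℕ →₀ K) with hv
  have hc : (!![1, 0; 0, 0] : Matrix (Fin 2) (Fin 2) (GrassmannAlg K)) * !![0, u; v, 0]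
      - !![0, u; v, 0] * !![1, 0; 0, 0] = !![0, u; -v, 0] := by
    ext i j
    fin_cases i <;> fin_cases j <;> simp [Matrix.mul_apply, Fin.sum_univ_two]
  refine ⟨!![1, 0; 0, 0], !![0, u; v, 0], ?_, ?_, ?_⟩
  · refine ⟨?_, ?_, ?_, ?_⟩
    · exact SetLike.GradedOne.one_mem
    · exact zero_mem _
    · exact zero_mem _
    · exact zero_mem _
  · refine ⟨?_, ?_, ?_, ?_⟩
    · exact zero_mem _
    · exact zero_mem _
    · exact CliffordAlgebra.ι_mem_evenOdd_one _ _
    · exact CliffordAlgebra.ι_mem_evenOdd_one _ _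
  · rw [hc, aux_iter]
    intro h
    rcases hk with rfl | rfl
    · have h1 := congrFun (congrFun h 1) 0
      simp at h1
      exact huv (by rw [h1, mul_zero])
    · have h1 := congrFun (congrFun h 0) 0
      simp [Matrix.mul_apply, Fin.sum_univ_two] at h1
      exact huv h1
end
end

section
/- For every integer k >= 2, every integer l >= 0, and all elements a, b in M11(E), one has [a,b]^k * [a,b,a^(l)] = 0; that is, the polynomial d_{k,l} = [x,y]^k [x,y,x^(l)] is a polynomial identity of M11(E). -/
noncomputable section

open CliffordAlgebra

section aux
variable {K M : Type*} [Field K] [AddCommGroup M] [Module K M]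

theorem aux_involute (x : CliffordAlgebra (0 : QuadraticForm K M)) (m : M) :
    x * ι 0 m = ι 0 m * involute x := by
  induction x using CliffordAlgebra.induction with
  | algebraMap r => simp [Algebra.commutes]
  | ι n =>
    have h := ι_mul_ι_add_swap (Q := (0 : QuadraticForm K M)) n m
    have h0 : QuadraticMap.polar (0 : QuadraticForm K M) n m = 0 := by
      simp [QuadraticMap.polar]
    rw [h0, map_zero] at h
    simp [eq_neg_of_add_eq_zero_left h]
  | mul a b ha hb => rw [mul_assoc, hb, ← mul_assoc, ha, map_mul, mul_assoc]
  | add a b ha hb => rw [add_mul, ha, hb, map_add, mul_add]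

theorem aux_even {x : CliffordAlgebra (0 : QuadraticForm K M)}
    (hx : x ∈ evenOdd (0 : QuadraticForm K M) 0) (y) : y * x = x * y := by
  induction y using CliffordAlgebra.induction with
  | algebraMap r => simp [Algebra.commutes]
  | ι n => rw [aux_involute, involute_eq_of_mem_even hx]
  | mul a b ha hb => rw [mul_assoc, hb, ← mul_assoc, ha, mul_assoc]
  | add a b ha hb => rw [add_mul, ha, hb, mul_add]

theorem aux_odd {x y : CliffordAlgebra (0 : QuadraticForm K M)}
    (hx : x ∈ evenOdd (0 : QuadraticForm K M) 1)
    (hy : y ∈ evenOdd (0 : QuadraticForm K M) 1) : y * x = - (x * y) := by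
  induction y, hy using odd_induction with
  | ι n => rw [aux_involute, involute_eq_of_mem_odd hx]; simp
  | add y z _ _ ha hb => rw [add_mul, ha, hb, mul_add]; abel
  | ι_mul_ι_mul m n y hy h =>
    rw [mul_assoc, h]
    have : x * (ι 0 m * ι 0 n) = (ι 0 m * ι 0 n) * x := by
      rw [← mul_assoc, aux_involute x, mul_assoc, aux_involute (involute x), involute_involute,
        mul_assoc]
    rw [← mul_assoc x, this]; noncomm_ring

theorem aux_odd_sq [CharZero K] {x : CliffordAlgebra (0 : QuadraticForm K M)}
    (hx : x ∈ evenOdd (0 : QuadraticForm K M) 1) : x * x = 0 := by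
  have h := aux_odd hx hx
  have h2 : (2 : K) • (x * x) = 0 := by
    rw [two_smul]; nth_rewrite 1 [h]; simp
  exact (smul_eq_zero.1 h2).resolve_left two_ne_zero
end aux

set_option linter.unusedSimpArgs false in
theorem aux_rel {R : Type*} [Ring R] {d e u v s w : R}
    (hd : ∀ y, y * d = d * y) (he : ∀ y, y * e = e * y)
    (uu : u * u = 0) (vv : v * v = 0) (ss : s * s = 0) (ww : w * w = 0)
    (vu : v * u = -(u * v)) (su : s * u = -(u * s)) (wu : w * u = -(u * w))
    (sv : s * v = -(v * s)) (wv : w * v = -(v * w)) (ws : w * s = -(s * w))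
    {f α β : R} (hf : f = u * w - s * v) (hα : α = d * s - e * u) (hβ : β = e * v - d * w) :
    f * f * f = 0 ∧ f * f * α = 0 ∧ f * f * β = 0 ∧ f * (α * β) = 0 := by
  have uu' := fun z => congrArg (· * z) uu
  have vv' := fun z => congrArg (· * z) vv
  have ss' := fun z => congrArg (· * z) ss
  have ww' := fun z => congrArg (· * z) ww
  have vu' := fun z => congrArg (· * z) vu
  have su' := fun z => congrArg (· * z) su
  have wu' := fun z => congrArg (· * z) wu
  have sv' := fun z => congrArg (· * z) sv
  have wv' := fun z => congrArg (· * z) wv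
  have ws' := fun z => congrArg (· * z) ws
  have du := hd u
  have dv := hd v
  have ds := hd s
  have dw := hd w
  have eu := he u
  have ev := he v
  have es := he s
  have ew := he w
  have ed := hd e
  have du' := fun z => congrArg (· * z) du
  have dv' := fun z => congrArg (· * z) dv
  have ds' := fun z => congrArg (· * z) ds
  have dw' := fun z => congrArg (· * z) dw
  have eu' := fun z => congrArg (· * z) eu
  have ev' := fun z => congrArg (· * z) ev
  have es' := fun z => congrArg (· * z) es
  have ew' := fun z => congrArg (· * z) ew
  have ed' := fun z => congrArg (· * z) ed
  simp only [mul_assoc, neg_mul, zero_mul] at uu' vv' ss' ww' vu' su' wu' sv' wv' ws' du' dv' ds' dw' eu' ev' es' ew' ed'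
  subst hf hα hβ
  refine ⟨?_, ?_, ?_, ?_⟩ <;>
  · simp only [mul_add, add_mul, mul_sub, sub_mul, mul_assoc, neg_mul, mul_neg, zero_mul, mul_zero,
      neg_neg, neg_zero, sub_zero, zero_sub, add_zero, zero_add,
      uu, vv, ss, ww, vu, su, wu, sv, wv, ws, du, dv, ds, dw, eu, ev, es, ew, ed,
      uu', vv', ss', ww', vu', su', wu', sv', wv', ws', du', dv', ds', dw', eu', ev', es', ew', ed']
    try abel

theorem aux_step {R : Type*} [Ring R] {f α β g x y : R} (hf : ∀ z, z * f = f * z)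
    (hx : ∀ z, z * x = x * z) (hy : ∀ z, z * y = y * z)
    (aa : α * α = 0) (bb : β * β = 0) (ba : β * α = -(α * β))
    (h2a : f * f * α = 0) (h2b : f * f * β = 0) (hab : f * (α * β) = 0)
    (g1 : f * f * g = 0) (g2 : α * β * g = 0) (g3 : f * α * g = 0) (g4 : f * β * g = 0) :
    !![f, α; β, f] ^ 2 * !![g, x * α; y * β, g] = 0 := by
  have hfa : f * α = α * f := (hf α).symm
  have hfb : f * β = β * f := (hf β).symm
  have bab : β * α * β = 0 := by rw [ba, neg_mul, mul_assoc, bb]; simp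
  have c2 : !![f, α; β, f] ^ 2 = !![f * f + α * β, 2 * (f * α); 2 * (f * β), f * f - α * β] := by
    rw [pow_two, Matrix.mul_fin_two, ba, ← hfa, ← hfb, two_mul, two_mul]
    congr! 3; abel
  rw [c2, Matrix.mul_fin_two]
  have t1 : f * α * (y * β) = 0 := by
    rw [← mul_assoc, hy, mul_assoc y, mul_assoc f, hab, mul_zero]
  have t2 : f * β * (x * α) = 0 := by
    rw [← mul_assoc, hx, mul_assoc x, mul_assoc f, ba, mul_neg, hab, neg_zero, mul_zero]
  have t3 : α * β * (x * α) = 0 := by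
    rw [← mul_assoc, hx, mul_assoc x, mul_assoc α, ba, mul_neg, ← mul_assoc α, aa]; simp
  have t4 : α * β * (y * β) = 0 := by
    rw [← mul_assoc, hy, mul_assoc y, mul_assoc α, bb]; simp
  have t5 : f * f * (x * α) = 0 := by rw [← mul_assoc, hx, mul_assoc x, h2a, mul_zero]
  have t6 : f * f * (y * β) = 0 := by rw [← mul_assoc, hy, mul_assoc y, h2b, mul_zero]
  have t0 : (0 : Matrix (Fin 2) (Fin 2) R) = !![0,0;0,0] := by ext i j; fin_cases i <;> fin_cases j <;> rfl
  rw [t0]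
  simp only [add_mul, sub_mul, g1, g2, mul_assoc (2 : R), g3, g4, t1, t2, t3, t4, t5, t6]
  simp

theorem aux_kill {R : Type*} [Ring R] {α β x y u v X : R}
    (hx : ∀ z, z * x = x * z) (hy : ∀ z, z * y = y * z) (ha : X * α = 0) (hb : X * β = 0) :
    X * (x * α * v + y * β * u) = 0 := by
  rw [mul_add, ← mul_assoc, ← mul_assoc, ← mul_assoc, ← mul_assoc, hx, hy, mul_assoc x,
    mul_assoc y, ha, hb]
  simp

/- STATEMENT 15: for every k ≥ 2 and l ≥ 0, the polynomial d_{k,l} = [x,y]^k [x,y,x^(l)] is a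
polynomial identity of M11(E). -/
theorem stmt15 (K : Type*) [Field K] [CharZero K] (k : ℕ) (hk : 2 ≤ k) (l : ℕ)
    (a b : Matrix (Fin 2) (Fin 2) (GrassmannAlg K)) (ha : a ∈ M11 K) (hb : b ∈ M11 K) :
    (a * b - b * a) ^ k * adIter a l (a * b - b * a) = 0 := by
  obtain ⟨hp, hq, hu, hv⟩ := ha
  obtain ⟨hr, ht, hs, hw⟩ := hb
  rw [Matrix.eta_fin_two a, Matrix.eta_fin_two b]
  generalize a 0 0 = p at *
  generalize a 1 1 = q at *
  generalize a 0 1 = u at *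
  generalize a 1 0 = v at *
  generalize b 0 0 = r at *
  generalize b 1 1 = t at *
  generalize b 0 1 = s at *
  generalize b 1 0 = w at *
  have m00 : ∀ {x y : GrassmannAlg K}, x ∈ evenOdd (0 : QuadraticForm K (ℕ →₀ K)) 0 →
      y ∈ evenOdd (0 : QuadraticForm K (ℕ →₀ K)) 0 →
      x * y ∈ evenOdd (0 : QuadraticForm K (ℕ →₀ K)) 0 := fun hx hy =>
    (show ((0 : ZMod 2) + 0) = 0 by decide) ▸ SetLike.mul_mem_graded hx hy
  have m01 : ∀ {x y : GrassmannAlg K}, x ∈ evenOdd (0 : QuadraticForm K (ℕ →₀ K)) 0 →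
      y ∈ evenOdd (0 : QuadraticForm K (ℕ →₀ K)) 1 →
      x * y ∈ evenOdd (0 : QuadraticForm K (ℕ →₀ K)) 1 := fun hx hy =>
    (show ((0 : ZMod 2) + 1) = 1 by decide) ▸ SetLike.mul_mem_graded hx hy
  have m11 : ∀ {x y : GrassmannAlg K}, x ∈ evenOdd (0 : QuadraticForm K (ℕ →₀ K)) 1 →
      y ∈ evenOdd (0 : QuadraticForm K (ℕ →₀ K)) 1 →
      x * y ∈ evenOdd (0 : QuadraticForm K (ℕ →₀ K)) 0 := fun hx hy =>
    (show ((1 : ZMod 2) + 1) = 0 by decide) ▸ SetLike.mul_mem_graded hx hy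
  have hd := sub_mem hp hq
  have he := sub_mem hr ht
  obtain ⟨f, hf⟩ : ∃ f, f = u * w - s * v := ⟨_, rfl⟩
  obtain ⟨α, hα⟩ : ∃ α, α = (p - q) * s - (r - t) * u := ⟨_, rfl⟩
  obtain ⟨β, hβ⟩ : ∃ β, β = (r - t) * v - (p - q) * w := ⟨_, rfl⟩
  have fm : f ∈ evenOdd (0 : QuadraticForm K (ℕ →₀ K)) 0 := hf ▸ sub_mem (m11 hu hw) (m11 hs hv)
  have am : α ∈ evenOdd (0 : QuadraticForm K (ℕ →₀ K)) 1 := hα ▸ sub_mem (m01 hd hs) (m01 he hu)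
  have bm : β ∈ evenOdd (0 : QuadraticForm K (ℕ →₀ K)) 1 := hβ ▸ sub_mem (m01 he hv) (m01 hd hw)
  obtain ⟨h3, h2a, h2b, hab⟩ := aux_rel (aux_even hd) (aux_even he) (aux_odd_sq hu)
    (aux_odd_sq hv) (aux_odd_sq hs) (aux_odd_sq hw) (aux_odd hu hv) (aux_odd hu hs)
    (aux_odd hu hw) (aux_odd hv hs) (aux_odd hv hw) (aux_odd hs hw) hf hα hβ
  have aa := aux_odd_sq am
  have bb := aux_odd_sq bm
  have ba := aux_odd am bm
  have hc : !![p, u; v, q] * !![r, s; w, t] - !![r, s; w, t] * !![p, u; v, q]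
      = !![f, α; β, f] := by
    rw [Matrix.mul_fin_two, Matrix.mul_fin_two, hf, hα, hβ, aux_odd hu hw, aux_odd hv hs,
      aux_even hr p, aux_even ht u, aux_even hq s, aux_even hr v, aux_even hp w, aux_even ht q]
    ext i j
    fin_cases i <;> fin_cases j <;> simp [sub_mul] <;> abel
  rw [hc]
  have key : ∃ x y g : GrassmannAlg K, x ∈ evenOdd (0 : QuadraticForm K (ℕ →₀ K)) 0 ∧
      y ∈ evenOdd (0 : QuadraticForm K (ℕ →₀ K)) 0 ∧
      g ∈ evenOdd (0 : QuadraticForm K (ℕ →₀ K)) 0 ∧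
      f * f * g = 0 ∧ α * β * g = 0 ∧ f * α * g = 0 ∧ f * β * g = 0 ∧
      adIter !![p, u; v, q] l !![f, α; β, f] = !![g, x * α; y * β, g] := by
    clear hc
    induction l with
    | zero =>
      refine ⟨1, 1, f, SetLike.GradedOne.one_mem, SetLike.GradedOne.one_mem, fm, h3, ?_, ?_, ?_, ?_⟩
      · rw [aux_even fm, hab]
      · rw [aux_even fm, ← mul_assoc, h2a]
      · rw [aux_even fm, ← mul_assoc, h2b]
      · simp [adIter]
    | succ l ih =>
      obtain ⟨x, y, g, hx, hy, hg, -, -, -, -, h⟩ := ih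
      have cx := aux_even hx
      have cy := aux_even hy
      refine ⟨-((p - q) * x), (p - q) * y, x * α * v + y * β * u, neg_mem (m00 hd hx), m00 hd hy,
        add_mem (m11 (m01 hx am) hv) (m11 (m01 hy bm) hu), ?_, ?_, ?_, ?_, ?_⟩
      · exact aux_kill cx cy h2a h2b
      · refine aux_kill cx cy ?_ ?_
        · rw [mul_assoc, ba, mul_neg, ← mul_assoc, aa]; simp
        · rw [mul_assoc, bb]; simp
      · refine aux_kill cx cy ?_ ?_
        · rw [mul_assoc, aa]; simp
        · rw [mul_assoc, hab]
      · refine aux_kill cx cy ?_ ?_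
        · rw [mul_assoc, ba, mul_neg, hab]; simp
        · rw [mul_assoc, bb]; simp
      · have e : adIter !![p, u; v, q] (l + 1) !![f, α; β, f]
            = !![g, x * α; y * β, g] * !![p, u; v, q] - !![p, u; v, q] * !![g, x * α; y * β, g] := by
          rw [← h]; unfold adIter; rw [Function.iterate_succ_apply']
        rw [e, Matrix.mul_fin_two, Matrix.mul_fin_two, aux_even hg p, aux_even hg u,
          aux_even hg v, aux_even hg q, aux_odd (m01 hy bm) hu, aux_odd (m01 hx am) hv,
          aux_even hq (x * α), aux_even hp (y * β)]
        ext i j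
        fin_cases i <;> fin_cases j <;> simp [sub_mul, mul_assoc] <;> abel
  obtain ⟨x, y, g, hx, hy, hg, g1, g2, g3, g4, h⟩ := key
  obtain ⟨n, rfl⟩ := Nat.exists_eq_add_of_le' hk
  rw [h, pow_add, mul_assoc, aux_step (aux_even fm) (aux_even hx) (aux_even hy) aa bb ba h2a h2b hab
    g1 g2 g3 g4, mul_zero]
end
end
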